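/- For every positive integer n, the number of representations of n by x1^2 + 2x2^2 + 3x3^2 + 4x4^2 + 4x5^2 + 6(x6^2+x7^2+x8^2) equals (1/8)σ3(n) − (1/8)σ3(n/2) − (9/8)σ3(n/3) + (9/8)σ3(n/6) + 2σ3(n/8) − 32σ3(n/16) − 18σ3(n/24) + 288σ3(n/48) − 4a6(n/4) − 32a6(n/8) − (1/8)a8(n) − (5/2)a8(n/2) + (9/8)a8(n/3) − (27/2)a8(n/6) + (3/8)a12(n) + 2a12(n/2) + 6a12(n/4) − (1/4)a16(n) − (9/4)a16(n/3) + (5/8)χ4(n)a24(n) + (3/2)χ4(n/2)a24(n/2) + χ−4(n)a6(n) + (1/2)χ−4(n)a12(n) − (1/4)χ−4(n)a24(n), with all terms whose argument is not a positive integer interpreted as 0. -/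

import Mathlib

open Complex Real Finset

/-- The Dedekind eta function `η(z) = q^{1/24} ∏ (1 - q^m)`, `q = e^{2πiz}`. -/
noncomputable def dedekindEta (z : ℂ) : ℂ :=
  Complex.exp (Real.pi * Complex.I * z / 12) *
    ∏' m : ℕ, (1 - Complex.exp (2 * Real.pi * Complex.I * (m + 1) * z))

/-- `repCount a n` is the number of `(x₁,…,x₈) ∈ ℤ⁸` with `∑ aᵢ xᵢ² = n`. -/
noncomputable def repCount (a : Fin 8 → ℕ) (n : ℕ) : ℕ :=
  Nat.card {x : Fin 8 → ℤ // ∑ i, (a i : ℤ) * x i ^ 2 = (n : ℤ)}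

/-- `σ₃(n) = ∑_{d ∣ n} d³`. -/
def sigma3 (n : ℕ) : ℤ := ∑ d ∈ n.divisors, (d : ℤ) ^ 3

/-- `σ_{3;χ₋₄,χ₋₄}(n) = ∑_{d ∣ n} χ₋₄(d) χ₋₄(n/d) d³`. -/
def sigmaChi4Chi4 (n : ℕ) : ℤ :=
  ∑ d ∈ n.divisors, ZMod.χ₄ (d : ZMod 4) * ZMod.χ₄ ((n / d : ℕ) : ZMod 4) * (d : ℤ) ^ 3

/-- `χ₋₄ = (−4/·)`, the nontrivial character mod 4, as an integer-valued function on `ℕ`. -/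
def chiMinus4 (n : ℕ) : ℤ := ZMod.χ₄ (n : ZMod 4)

/-- `χ₄ = (4/·)`: `1` on odd integers, `0` on even integers. -/
def chi4 (n : ℕ) : ℤ := if n % 2 = 1 then 1 else 0

/-- `f(n/k)` when `k ∣ n`, and `0` otherwise. -/
def Dv (f : ℕ → ℤ) (k n : ℕ) : ℚ := if k ∣ n then (f (n / k) : ℚ) else 0


namespace RF
open Filter Topology

lemma exists_tau {q : ℂ} (hq0 : q ≠ 0) (hq : ‖q‖ < 1) :
    ∃ τ : ℂ, 0 < τ.im ∧ Complex.exp (Real.pi * Complex.I * τ) = q := by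
  refine ⟨Complex.log q / (Real.pi * Complex.I), ?_, ?_⟩
  · have : Complex.log q / (Real.pi * Complex.I) = -(Complex.log q * Complex.I) / (Real.pi : ℂ) := by
      field_simp
      rw [Complex.I_sq]; ring
    rw [this, Complex.div_ofReal_im]
    have h1 : Real.log ‖q‖ < 0 := Real.log_neg (norm_pos_iff.mpr hq0) hq
    have : (-(Complex.log q * Complex.I)).im = - Real.log ‖q‖ := by simp [Complex.log_re]
    rw [this]
    exact div_pos (by linarith) Real.pi_pos
  · rw [mul_div_cancel₀, Complex.exp_log hq0]
    simp [Real.pi_ne_zero]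

lemma summable_theta {q z : ℂ} (hq0 : q ≠ 0) (hq : ‖q‖ < 1) (hz : z ≠ 0) :
    Summable fun n : ℤ => q ^ (n ^ 2) * z ^ n := by
  obtain ⟨τ, hτ, rfl⟩ := exists_tau hq0 hq
  have := (summable_jacobiTheta₂_term_iff (Complex.log z / (2 * Real.pi * Complex.I)) τ).2 hτ
  refine this.congr fun n => ?_
  rw [jacobiTheta₂_term, Complex.exp_add, mul_comm]
  congr 1
  · rw [← Complex.exp_int_mul]; congr 1; push_cast; ring
  · have : 2 * (Real.pi:ℂ) * Complex.I * n * (Complex.log z / (2 * Real.pi * Complex.I)) = n * Complex.log z := by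
      field_simp
    rw [this, Complex.exp_int_mul, Complex.exp_log hz]

/-- finite Pochhammer -/
def poch (Q : ℂ) (n : ℕ) : ℂ := ∏ k ∈ Finset.range n, (1 - Q ^ (k + 1))

lemma one_sub_pow_ne {Q : ℂ} (hQ : ‖Q‖ < 1) (k : ℕ) : 1 - Q ^ (k + 1) ≠ 0 := by
  intro h
  have h2 : ‖Q ^ (k + 1)‖ < 1 := by
    rw [norm_pow]; exact pow_lt_one₀ (norm_nonneg _) hQ (by omega)
  rw [← sub_eq_zero.mp h] at h2
  simp at h2

lemma poch_ne {Q : ℂ} (hQ : ‖Q‖ < 1) (n : ℕ) : poch Q n ≠ 0 :=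
  Finset.prod_ne_zero_iff.mpr fun k _ => one_sub_pow_ne hQ k

noncomputable def rfac (Q : ℂ) (m : ℤ) : ℂ := if 0 ≤ m then (poch Q m.toNat)⁻¹ else 0

lemma rfac_pred {Q : ℂ} (hQ : ‖Q‖ < 1) (m : ℤ) :
    rfac Q (m - 1) = rfac Q m * (1 - Q ^ m) := by
  rcases lt_trichotomy m 0 with h | h | h
  · simp [rfac, show ¬ (0 ≤ m) by omega, show ¬ (1 ≤ m) by omega]
  · subst h; simp [rfac]
  · obtain ⟨k, rfl⟩ : ∃ k : ℕ, m = k + 1 := ⟨(m - 1).toNat, by omega⟩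
    have h1 : ((k : ℤ) + 1).toNat = k + 1 := by omega
    have h3 : (Q ^ ((k : ℤ) + 1)) = Q ^ (k + 1) := by norm_cast
    simp only [rfac, add_sub_cancel_right, Int.toNat_natCast, h1, Int.natCast_nonneg, if_true,
      show (0:ℤ) ≤ k + 1 by omega, h3]
    have h2 : poch Q (k + 1) = poch Q k * (1 - Q ^ (k + 1)) := Finset.prod_range_succ _ _
    rw [h2, mul_inv, mul_assoc, inv_mul_cancel₀ (one_sub_pow_ne hQ k), mul_one]

noncomputable def cc (Q : ℂ) (n : ℕ) (j : ℤ) : ℂ := poch Q (2 * n) * rfac Q (n - j) * rfac Q (n + j)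

lemma cc_succ {Q : ℂ} (hQ0 : Q ≠ 0) (hQ : ‖Q‖ < 1) (n : ℕ) (j : ℤ) :
    cc Q (n + 1) j = (1 + Q ^ (2 * n + 1)) * cc Q n j + Q ^ ((n : ℤ) + 1 - j) * cc Q n (j - 1)
      + Q ^ ((n : ℤ) + 1 + j) * cc Q n (j + 1) := by
  have e1 : poch Q (2 * (n + 1)) = poch Q (2 * n) * (1 - Q ^ (2 * n + 1)) * (1 - Q ^ (2 * n + 2)) := by
    rw [show 2 * (n + 1) = 2 * n + 1 + 1 by ring]
    rw [poch, Finset.prod_range_succ, Finset.prod_range_succ]; rfl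
  have a1 : rfac Q ((n : ℤ) - j) = rfac Q (n + 1 - j) * (1 - Q ^ ((n : ℤ) + 1 - j)) := by
    rw [← rfac_pred hQ]; congr 1; ring
  have a2 : rfac Q ((n : ℤ) - (j + 1)) = rfac Q (n + 1 - j) * (1 - Q ^ ((n : ℤ) + 1 - j)) * (1 - Q ^ ((n : ℤ) - j)) := by
    rw [← a1, ← rfac_pred hQ]; congr 1; ring
  have b1 : rfac Q ((n : ℤ) + j) = rfac Q (n + 1 + j) * (1 - Q ^ ((n : ℤ) + 1 + j)) := by
    rw [← rfac_pred hQ]; congr 1; ring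
  have b2 : rfac Q ((n : ℤ) + (j - 1)) = rfac Q (n + 1 + j) * (1 - Q ^ ((n : ℤ) + 1 + j)) * (1 - Q ^ ((n : ℤ) + j)) := by
    rw [← b1, ← rfac_pred hQ]; congr 1; ring
  have a3 : rfac Q ((n : ℤ) - (j - 1)) = rfac Q (n + 1 - j) := by congr 1; ring
  have b3 : rfac Q ((n : ℤ) + (j + 1)) = rfac Q (n + 1 + j) := by congr 1; ring
  have z1 : Q ^ ((n : ℤ) + 1 - j) = Q * Q ^ ((n : ℤ) - j) := by
    rw [show (n : ℤ) + 1 - j = 1 + (n - j) by ring, zpow_add₀ hQ0, zpow_one]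
  have z2 : Q ^ ((n : ℤ) + 1 + j) = Q * Q ^ ((n : ℤ) + j) := by
    rw [show (n : ℤ) + 1 + j = 1 + (n + j) by ring, zpow_add₀ hQ0, zpow_one]
  have z3 : Q ^ (2 * n) = Q ^ ((n : ℤ) - j) * Q ^ ((n : ℤ) + j) := by
    rw [← zpow_add₀ hQ0, ← zpow_natCast]; congr 1; push_cast; ring
  unfold cc
  rw [e1, a1, a2, b1, b2, a3, b3, pow_add, pow_add, z3]
  push_cast
  rw [z1, z2]
  ring

lemma HasSum.congr_fun' {f g : ℤ → ℂ} {a b : ℂ} (h : HasSum f a) (hfg : ∀ j, g j = f j) (hab : b = a) :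
    HasSum g b := by
  rw [hab, show g = f from funext hfg]; exact h

lemma hasSum_finite {q z : ℂ} (hq0 : q ≠ 0) (hq : ‖q‖ < 1) (hz : z ≠ 0) (n : ℕ) :
    HasSum (fun j : ℤ => cc (q ^ 2) n j * (q ^ (j ^ 2) * z ^ j))
      (∏ k ∈ Finset.range n, ((1 + z * q ^ (2 * k + 1)) * (1 + z⁻¹ * q ^ (2 * k + 1)))) := by
  have hQ0 : q ^ 2 ≠ 0 := pow_ne_zero _ hq0
  have hQ : ‖q ^ 2‖ < 1 := by rw [norm_pow]; exact pow_lt_one₀ (norm_nonneg _) hq (by norm_num)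
  induction n with
  | zero =>
    have : ∏ k ∈ Finset.range 0, ((1 + z * q ^ (2 * k + 1)) * (1 + z⁻¹ * q ^ (2 * k + 1))) =
      cc (q ^ 2) 0 0 * (q ^ ((0:ℤ) ^ 2) * z ^ (0:ℤ)) := by simp [cc, poch, rfac]
    rw [this]
    refine hasSum_single 0 fun j hj => ?_
    rcases lt_or_gt_of_ne hj with h | h
    · simp [cc, rfac, h]
    · simp [cc, rfac, h]
  | succ n ih =>
    have s1 := (Equiv.subRight (1 : ℤ)).hasSum_iff.mpr ih
    have s2 := (Equiv.addRight (1 : ℤ)).hasSum_iff.mpr ih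
    have s := ((ih.mul_left (1 + q ^ (4 * n + 2))).add (s1.mul_left (q ^ (2 * n + 1) * z))).add
      (s2.mul_left (q ^ (2 * n + 1) * z⁻¹))
    rw [Finset.prod_range_succ]
    refine HasSum.congr_fun' s ?_ ?_
    · intro j
      simp only [Function.comp, Equiv.subRight_apply, Equiv.coe_addRight]
      rw [cc_succ hQ0 hQ]
      have w1 : (q ^ 2) ^ ((n : ℤ) + 1 - j) * q ^ (j ^ 2) * z ^ j
          = q ^ (2 * n + 1) * z * (q ^ ((j - 1) ^ 2) * z ^ (j - 1)) := by
        rw [zpow_sub₀ hz, zpow_one, ← zpow_natCast q 2, ← zpow_mul, ← zpow_natCast q (2 * n + 1)]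
        rw [← zpow_add₀ hq0]
        have : q ^ (((2 * n + 1 : ℕ) : ℤ)) * z * (q ^ ((j - 1) ^ 2) * (z ^ j / z)) =
          (q ^ (((2 * n + 1 : ℕ) : ℤ)) * q ^ ((j - 1) ^ 2)) * z ^ j := by field_simp
        rw [this, ← zpow_add₀ hq0]; congr 2; push_cast; ring
      have w2 : (q ^ 2) ^ ((n : ℤ) + 1 + j) * q ^ (j ^ 2) * z ^ j
          = q ^ (2 * n + 1) * z⁻¹ * (q ^ ((j + 1) ^ 2) * z ^ (j + 1)) := by
        rw [zpow_add₀ hz, zpow_one, ← zpow_natCast q 2, ← zpow_mul, ← zpow_natCast q (2 * n + 1)]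
        rw [← zpow_add₀ hq0]
        have : q ^ (((2 * n + 1 : ℕ) : ℤ)) * z⁻¹ * (q ^ ((j + 1) ^ 2) * (z ^ j * z)) =
          (q ^ (((2 * n + 1 : ℕ) : ℤ)) * q ^ ((j + 1) ^ 2)) * z ^ j := by field_simp
        rw [this, ← zpow_add₀ hq0]; congr 2; push_cast; ring
      have w3 : (q ^ 2) ^ (2 * n + 1) = q ^ (4 * n + 2) := by rw [← pow_mul]; congr 1; ring
      rw [w3]
      linear_combination cc (q ^ 2) n (j - 1) * w1 + cc (q ^ 2) n (j + 1) * w2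
    · generalize (∏ k ∈ Finset.range n, _ : ℂ) = S
      have : q ^ (4 * n + 2) = q ^ (2 * n + 1) * q ^ (2 * n + 1) := by rw [← pow_add]; congr 1; ring
      rw [this]; field_simp; ring

noncomputable def E (q : ℂ) : ℂ := ∏' n : ℕ, (1 - q ^ (n + 1))

lemma multipliable_one_add {a : ℂ} {q : ℂ} (hq : ‖q‖ < 1) {f : ℕ → ℕ} (hf : Function.Injective f) :
    Multipliable fun n : ℕ => 1 + a * q ^ (f n) := by
  apply multipliable_one_add_of_summable
  have : Summable fun n : ℕ => ‖q‖ ^ n := summable_geometric_of_lt_one (norm_nonneg _) hq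
  have := (this.comp_injective hf).mul_left ‖a‖
  refine Summable.of_nonneg_of_le (fun n => norm_nonneg (a * q ^ f n)) (fun n => ?_) this
  simp

lemma multipliable_E {q : ℂ} (hq : ‖q‖ < 1) : Multipliable fun n : ℕ => 1 - q ^ (n + 1) := by
  have := multipliable_one_add (a := -1) hq (f := fun n => n + 1) (fun a b h => by simpa using h)
  simpa [sub_eq_add_neg] using this

lemma E_ne {q : ℂ} (hq : ‖q‖ < 1) : E q ≠ 0 := by
  by_cases h0 : q = 0
  · simp [E, h0]
  obtain ⟨τ, hτ, h⟩ := exists_tau h0 hq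
  have := ModularForm.eta_tprod_ne_zero (z := τ / 2) (by simpa [UpperHalfPlane.upperHalfPlaneSet] using hτ)
  unfold E
  convert this using 4 with n
  rw [ModularForm.eta_q_eq_pow, ← h]
  congr 2; ring

lemma poch_tendsto {q : ℂ} (hq : ‖q‖ < 1) : Tendsto (poch q) atTop (𝓝 (E q)) :=
  (multipliable_E hq).hasProd.tendsto_prod_nat

lemma jtp {q z : ℂ} (hq0 : q ≠ 0) (hq : ‖q‖ < 1) (hz : z ≠ 0) :
    ∑' j : ℤ, q ^ (j ^ 2) * z ^ j =
      E (q ^ 2) * (∏' n : ℕ, (1 + z * q ^ (2 * n + 1))) * (∏' n : ℕ, (1 + z⁻¹ * q ^ (2 * n + 1))) := by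
  have hQ : ‖q ^ 2‖ < 1 := by rw [norm_pow]; exact pow_lt_one₀ (norm_nonneg _) hq (by norm_num)
  have hE := E_ne hQ
  have hp := poch_tendsto hQ
  have hpi : Tendsto (fun n => (poch (q ^ 2) n)⁻¹) atTop (𝓝 (E (q ^ 2))⁻¹) := hp.inv₀ hE
  obtain ⟨K1, hK1⟩ := hp.norm.bddAbove_range
  obtain ⟨K2, hK2⟩ := hpi.norm.bddAbove_range
  have k1 : ∀ n, ‖poch (q ^ 2) n‖ ≤ K1 := fun n => hK1 ⟨n, rfl⟩
  have k2 : ∀ m, ‖rfac (q ^ 2) m‖ ≤ K2 := fun m => by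
    unfold rfac
    split_ifs
    · exact hK2 ⟨m.toNat, rfl⟩
    · simpa using (norm_nonneg _).trans (hK2 ⟨0, rfl⟩)
  have k10 : 0 ≤ K1 := (norm_nonneg _).trans (k1 0)
  have k20 : 0 ≤ K2 := (norm_nonneg _).trans (k2 0)
  have hodd : Function.Injective (fun n : ℕ => 2 * n + 1) := fun a b h => by simpa using h
  have T1 := ((multipliable_one_add (a := z) hq hodd).hasProd.tendsto_prod_nat).mul
    ((multipliable_one_add (a := z⁻¹) hq hodd).hasProd.tendsto_prod_nat)
  have T2 : Tendsto (fun n => ∑' j : ℤ, cc (q ^ 2) n j * (q ^ (j ^ 2) * z ^ j)) atTop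
      (𝓝 (∑' j : ℤ, (E (q ^ 2))⁻¹ * (q ^ (j ^ 2) * z ^ j))) := by
    refine tendsto_tsum_of_dominated_convergence
      (bound := fun j : ℤ => (K1 * K2 * K2) * ‖q ^ (j ^ 2) * z ^ j‖)
      ((summable_theta hq0 hq hz).norm.mul_left _) ?_ ?_
    · intro j
      refine Tendsto.mul_const _ ?_
      have l1 : Tendsto (fun n : ℕ => rfac (q ^ 2) ((n : ℤ) - j)) atTop (𝓝 (E (q ^ 2))⁻¹) := by
        have : Tendsto (fun n : ℕ => ((n : ℤ) - j).toNat) atTop atTop := by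
          refine tendsto_atTop.2 fun b => ?_
          filter_upwards [eventually_ge_atTop (b + j.toNat)] with n hn
          omega
        refine (hpi.comp this).congr' ?_
        filter_upwards [eventually_ge_atTop (j.toNat)] with n hn
        have : 0 ≤ (n : ℤ) - j := by omega
        simp only [rfac, this, if_true, Function.comp]
      have l2 : Tendsto (fun n : ℕ => rfac (q ^ 2) ((n : ℤ) + j)) atTop (𝓝 (E (q ^ 2))⁻¹) := by
        have : Tendsto (fun n : ℕ => ((n : ℤ) + j).toNat) atTop atTop := by
          refine tendsto_atTop.2 fun b => ?_
          filter_upwards [eventually_ge_atTop (b + (-j).toNat)] with n hn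
          omega
        refine (hpi.comp this).congr' ?_
        filter_upwards [eventually_ge_atTop ((-j).toNat)] with n hn
        have : 0 ≤ (n : ℤ) + j := by omega
        simp only [rfac, this, if_true, Function.comp]
      have l0 : Tendsto (fun n : ℕ => poch (q ^ 2) (2 * n)) atTop (𝓝 (E (q ^ 2))) :=
        hp.comp (tendsto_id.const_mul_atTop' (by norm_num))
      have := (l0.mul l1).mul l2
      rw [mul_inv_cancel₀ hE, one_mul] at this
      exact this
    · refine Eventually.of_forall fun n j => ?_
      rw [norm_mul]
      refine mul_le_mul_of_nonneg_right ?_ (norm_nonneg _)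
      unfold cc
      rw [norm_mul, norm_mul]
      have := k1 (2 * n); have := k2 (n - j); have := k2 (n + j)
      gcongr
  have T3 := T2.congr fun n => (hasSum_finite hq0 hq hz n).tsum_eq
  simp only [Finset.prod_mul_distrib] at T3
  have := tendsto_nhds_unique T3 T1
  rw [tsum_mul_left] at this
  rw [mul_assoc, ← this, mul_inv_cancel_left₀ hE]

end RF

namespace RF
open Filter Topology

noncomputable def phi (q : ℂ) : ℂ := ∑' n : ℤ, q ^ (n ^ 2)
noncomputable def psi (q : ℂ) : ℂ := ∑' n : ℤ, q ^ (2 * n ^ 2 - n)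
noncomputable def tri (q : ℂ) : ℂ := ∑' n : ℤ, q ^ (3 * n ^ 2 - 2 * n)
noncomputable def Od (q : ℂ) : ℂ := ∏' n : ℕ, (1 + q ^ (2 * n + 1))
noncomputable def Pl (q : ℂ) : ℂ := ∏' n : ℕ, (1 + q ^ (n + 1))

lemma norm_pow_lt {q : ℂ} (hq : ‖q‖ < 1) {k : ℕ} (hk : k ≠ 0) : ‖q ^ k‖ < 1 := by
  rw [norm_pow]; exact pow_lt_one₀ (norm_nonneg _) hq hk

lemma mult_add {q : ℂ} (hq : ‖q‖ < 1) {f : ℕ → ℕ} (hf : Function.Injective f) :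
    Multipliable fun n : ℕ => 1 + q ^ (f n) := by
  simpa using multipliable_one_add (a := 1) hq hf

lemma mult_sub {q : ℂ} (hq : ‖q‖ < 1) {f : ℕ → ℕ} (hf : Function.Injective f) :
    Multipliable fun n : ℕ => 1 - q ^ (f n) := by
  simpa [sub_eq_add_neg] using multipliable_one_add (a := -1) hq hf

lemma tprod_split2 {g : ℕ → ℂ} (h : Multipliable g) (h0 : Multipliable fun n => g (2 * n))
    (h1 : Multipliable fun n => g (2 * n + 1)) :
    ∏' n, g n = (∏' n, g (2 * n)) * ∏' n, g (2 * n + 1) := by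
  refine tendsto_nhds_unique (h.hasProd.tendsto_prod_nat.comp
    (tendsto_id.const_mul_atTop' (show 0 < 2 by norm_num))) ?_
  refine (h0.hasProd.tendsto_prod_nat.mul h1.hasProd.tendsto_prod_nat).congr fun n => ?_
  rw [← Finset.prod_mul_distrib]
  induction n with
  | zero => simp
  | succ n ih =>
    rw [Finset.prod_range_succ, ih]
    simp only [Function.comp, id, show 2 * (n + 1) = 2 * n + 1 + 1 by ring, Finset.prod_range_succ]
    ring

lemma tprod_split3 {g : ℕ → ℂ} (h : Multipliable g) (h0 : Multipliable fun n => g (3 * n))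
    (h1 : Multipliable fun n => g (3 * n + 1)) (h2 : Multipliable fun n => g (3 * n + 2)) :
    ∏' n, g n = (∏' n, g (3 * n)) * (∏' n, g (3 * n + 1)) * ∏' n, g (3 * n + 2) := by
  refine tendsto_nhds_unique (h.hasProd.tendsto_prod_nat.comp
    (tendsto_id.const_mul_atTop' (show 0 < 3 by norm_num))) ?_
  refine ((h0.hasProd.tendsto_prod_nat.mul h1.hasProd.tendsto_prod_nat).mul
    h2.hasProd.tendsto_prod_nat).congr fun n => ?_
  rw [← Finset.prod_mul_distrib, ← Finset.prod_mul_distrib]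
  induction n with
  | zero => simp
  | succ n ih =>
    rw [Finset.prod_range_succ, ih]
    simp only [Function.comp, id, show 3 * (n + 1) = 3 * n + 1 + 1 + 1 by ring, Finset.prod_range_succ]
    ring

lemma inj_lin (a b : ℕ) (ha : 0 < a) : Function.Injective fun n : ℕ => a * n + b := by
  intro m n h
  simp only [Nat.add_right_cancel_iff] at h
  exact Nat.eq_of_mul_eq_mul_left ha h

lemma E_neg_eq {q : ℂ} (hq : ‖q‖ < 1) : E (-q) = Od q * E (q ^ 2) := by
  have hq' : ‖-q‖ < 1 := by simpa using hq
  unfold E Od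
  rw [tprod_split2 (g := fun n => 1 - (-q) ^ (n + 1)) (multipliable_E hq')
    (mult_sub hq' (inj_lin 2 1 (by norm_num)))
    (mult_sub hq' (f := fun n => 2 * n + 1 + 1) (inj_lin 2 2 (by norm_num)))]
  congr 1
  · congr 1; funext n
    rw [Odd.neg_pow ⟨n, rfl⟩, sub_neg_eq_add]
  · congr 1; funext n
    rw [Even.neg_pow ⟨n + 1, by ring⟩, ← pow_mul]
    congr 2

lemma E_sq_eq {q : ℂ} (hq : ‖q‖ < 1) : E (q ^ 2) = E q * Pl q := by
  unfold E Pl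
  rw [← (multipliable_E hq).tprod_mul (mult_add hq (f := fun n => n + 1) (fun a b h => by simpa using h))]
  congr 1; funext n
  ring

lemma Pl_eq {q : ℂ} (hq : ‖q‖ < 1) : Pl q = Od q * Pl (q ^ 2) := by
  unfold Pl Od
  rw [tprod_split2 (g := fun n => 1 + q ^ (n + 1))
    (mult_add hq (f := fun n => n + 1) (fun a b h => by simpa using h))
    (mult_add hq (inj_lin 2 1 (by norm_num)))
    (mult_add hq (f := fun n => 2 * n + 1 + 1) (inj_lin 2 2 (by norm_num)))]
  congr 1
  congr 1; funext n
  rw [← pow_mul]; congr 2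

lemma Od_eq {q : ℂ} (hq : ‖q‖ < 1) : Od q = E (q ^ 2) ^ 2 / (E q * E (q ^ 4)) := by
  have h2 := norm_pow_lt hq two_ne_zero
  have n1 := E_ne hq
  have n2 := E_ne h2
  have n4 := E_ne (norm_pow_lt hq four_ne_zero)
  have e1 := E_sq_eq hq
  have e2 := E_sq_eq h2
  rw [← pow_mul] at e2
  norm_num at e2
  have e3 := Pl_eq hq
  rw [eq_div_iff (mul_ne_zero n1 n4)]
  rw [e2, show E (q ^ 2) ^ 2 = E (q ^ 2) * E (q ^ 2) by ring]
  nth_rewrite 3 [e1]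
  rw [e3]; ring

lemma E_neg {q : ℂ} (hq : ‖q‖ < 1) : E (-q) = E (q ^ 2) ^ 3 / (E q * E (q ^ 4)) := by
  rw [E_neg_eq hq, Od_eq hq]; ring

lemma phi_eq {q : ℂ} (hq0 : q ≠ 0) (hq : ‖q‖ < 1) :
    phi q = E (q ^ 2) ^ 5 / (E q ^ 2 * E (q ^ 4) ^ 2) := by
  have := jtp hq0 hq one_ne_zero
  simp only [one_zpow, mul_one, one_mul, inv_one] at this
  rw [phi, this]
  change E (q ^ 2) * Od q * Od q = _
  rw [Od_eq hq]; ring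

lemma phi_neg_eq {q : ℂ} (hq0 : q ≠ 0) (hq : ‖q‖ < 1) :
    phi (-q) = E q ^ 2 / E (q ^ 2) := by
  have h2 := norm_pow_lt hq two_ne_zero
  have n1 := E_ne hq
  have n2 := E_ne h2
  have n4 := E_ne (norm_pow_lt hq four_ne_zero)
  rw [phi_eq (neg_ne_zero.mpr hq0) (by simpa using hq), E_neg hq, neg_sq, Even.neg_pow (by decide)]
  field_simp

lemma psi_eq {q : ℂ} (hq0 : q ≠ 0) (hq : ‖q‖ < 1) :
    psi q = E (q ^ 2) ^ 2 / E q := by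
  have h2 := norm_pow_lt hq two_ne_zero
  have n1 := E_ne hq
  have n2 := E_ne h2
  have n4 := E_ne (norm_pow_lt hq four_ne_zero)
  have := jtp (pow_ne_zero 2 hq0) h2 (inv_ne_zero hq0)
  have e : psi q = ∑' j : ℤ, (q ^ 2) ^ (j ^ 2) * q⁻¹ ^ j := by
    unfold psi; congr 1; funext j
    rw [zpow_sub₀ hq0, inv_zpow, zpow_mul]; rfl
  rw [e, this]
  have s : Od q = (∏' n : ℕ, (1 + q⁻¹ * (q ^ 2) ^ (2 * n + 1))) * ∏' n : ℕ, (1 + q⁻¹⁻¹ * (q ^ 2) ^ (2 * n + 1)) := by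
    unfold Od
    rw [tprod_split2 (g := fun n => 1 + q ^ (2 * n + 1)) (mult_add hq (inj_lin 2 1 (by norm_num)))
      (mult_add hq (f := fun n => 2 * (2 * n) + 1) (fun a b h => by simpa using h))
      (mult_add hq (f := fun n => 2 * (2 * n + 1) + 1) (fun a b h => by simpa using h))]
    congr 1
    · congr 1; funext n
      rw [← pow_mul, show 2 * (2 * n + 1) = 2 * (2 * n) + 1 + 1 by ring, pow_succ q (2 * (2 * n) + 1)]
      field_simp
    · congr 1; funext n
      rw [← pow_mul, inv_inv, pow_succ]; ring
  rw [mul_assoc, ← s, Od_eq hq, ← pow_mul]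
  norm_num
  field_simp

lemma tri_eq {q : ℂ} (hq0 : q ≠ 0) (hq : ‖q‖ < 1) :
    tri q = E (q ^ 12) * E (q ^ 2) ^ 2 * E (q ^ 3) / (E (q ^ 6) * E q * E (q ^ 4)) := by
  have h3 := norm_pow_lt hq three_ne_zero
  have n1 := E_ne hq
  have n2 := E_ne (norm_pow_lt hq two_ne_zero)
  have n3 := E_ne h3
  have n4 := E_ne (norm_pow_lt hq four_ne_zero)
  have n6 := E_ne (norm_pow_lt hq (k := 6) (by norm_num))
  have n12 := E_ne (norm_pow_lt hq (k := 12) (by norm_num))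
  have := jtp (pow_ne_zero 3 hq0) h3 (inv_ne_zero (pow_ne_zero 2 hq0))
  have e : tri q = ∑' j : ℤ, (q ^ 3) ^ (j ^ 2) * (q ^ 2)⁻¹ ^ j := by
    unfold tri; congr 1; funext j
    rw [zpow_sub₀ hq0, inv_zpow, zpow_mul, zpow_mul]; rfl
  rw [e, this]
  have s : Od q = (∏' n : ℕ, (1 + (q ^ 2)⁻¹ * (q ^ 3) ^ (2 * n + 1))) * Od (q ^ 3)
      * ∏' n : ℕ, (1 + (q ^ 2)⁻¹⁻¹ * (q ^ 3) ^ (2 * n + 1)) := by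
    unfold Od
    rw [tprod_split3 (g := fun n => 1 + q ^ (2 * n + 1)) (mult_add hq (inj_lin 2 1 (by norm_num)))
      (mult_add hq (f := fun n => 2 * (3 * n) + 1) (fun a b h => by simpa using h))
      (mult_add hq (f := fun n => 2 * (3 * n + 1) + 1) (fun a b h => by simpa using h))
      (mult_add hq (f := fun n => 2 * (3 * n + 2) + 1) (fun a b h => by simpa using h))]
    congr 1
    · congr 1
      · congr 1; funext n
        rw [← pow_mul, show 3 * (2 * n + 1) = 2 * (3 * n) + 1 + 2 by ring, pow_add q (2 * (3 * n) + 1)]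
        field_simp
      · congr 1; funext n
        rw [← pow_mul]; congr 2; ring
    · congr 1; funext n
      rw [← pow_mul, inv_inv, ← pow_add]; congr 2; ring
  have o3 : Od (q ^ 3) = E (q ^ 6) ^ 2 / (E (q ^ 3) * E (q ^ 12)) := by
    rw [Od_eq h3, ← pow_mul, ← pow_mul]
  have o1 := Od_eq hq
  generalize (∏' n : ℕ, (1 + (q ^ 2)⁻¹ * (q ^ 3) ^ (2 * n + 1))) = a at *
  generalize (∏' n : ℕ, (1 + (q ^ 2)⁻¹⁻¹ * (q ^ 3) ^ (2 * n + 1))) = b at *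
  rw [o1, o3] at s
  rw [← pow_mul]
  norm_num
  field_simp at s ⊢
  linear_combination (-1 : ℂ) * s

lemma E_omega {q w : ℂ} (hq : ‖q‖ < 1) (hw : w ^ 2 + w + 1 = 0) :
    E q * E (w * q) * E (w ^ 2 * q) * E (q ^ 9) = E (q ^ 3) ^ 4 := by
  have w3 : w ^ 3 = 1 := by linear_combination (w - 1) * hw
  have nw : ‖w‖ = 1 := by
    have : ‖w‖ ^ 3 = 1 := by rw [← norm_pow, w3, norm_one]
    exact (pow_eq_one_iff_of_nonneg (norm_nonneg _) three_ne_zero).mp this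
  have h3 := norm_pow_lt hq three_ne_zero
  have h9 : ‖q ^ 9‖ < 1 := norm_pow_lt hq (by norm_num)
  have key : ∀ x : ℂ, ‖x‖ < 1 → E x = (∏' n : ℕ, (1 - x ^ (3 * n + 1))) * (∏' n : ℕ, (1 - x ^ (3 * n + 2))) * E (x ^ 3) := by
    intro x hx
    unfold E
    rw [tprod_split3 (g := fun n => 1 - x ^ (n + 1)) (multipliable_E hx)
      (mult_sub hx (f := fun n => (3 * n) + 1) (fun a b h => by simpa using h))
      (mult_sub hx (f := fun n => (3 * n + 1) + 1) (fun a b h => by simpa using h))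
      (mult_sub hx (f := fun n => (3 * n + 2) + 1) (fun a b h => by simpa using h))]
    congr 1
    congr 1; funext n
    rw [← pow_mul]; congr 2
  have hw1 : ‖w * q‖ < 1 := by rw [norm_mul, nw, one_mul]; exact hq
  have hw2 : ‖w ^ 2 * q‖ < 1 := by rw [norm_mul, norm_pow, nw, one_pow, one_mul]; exact hq
  have M : ∀ x : ℂ, ‖x‖ < 1 → ∀ i : ℕ, Multipliable fun n : ℕ => 1 - x ^ (3 * n + i) :=
    fun x hx i => mult_sub hx (inj_lin 3 i (by norm_num))
  have pr : ∀ i : ℕ, (i = 1 ∨ i = 2) → (∏' n : ℕ, (1 - q ^ (3 * n + i))) * (∏' n : ℕ, (1 - (w * q) ^ (3 * n + i)))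
      * (∏' n : ℕ, (1 - (w ^ 2 * q) ^ (3 * n + i))) = ∏' n : ℕ, (1 - (q ^ 3) ^ (3 * n + i)) := by
    intro i hi
    rw [← (M q hq i).tprod_mul (M _ hw1 i), ← ((M q hq i).mul (M _ hw1 i)).tprod_mul (M _ hw2 i)]
    congr 1; funext n
    rw [mul_pow, mul_pow, ← pow_mul, ← pow_mul, mul_comm 3 (3 * n + i), pow_mul q]
    generalize q ^ (3 * n + i) = y
    rw [pow_add w, pow_mul w, w3, one_pow, one_mul, mul_add, pow_add w, show 2 * (3 * n) = 3 * (2 * n) by ring, pow_mul w, w3, one_pow, one_mul]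
    rcases hi with rfl | rfl
    · linear_combination (-y + y ^ 2 * w - y ^ 3 * (w - 1)) * hw
    · linear_combination (-y * (w ^ 2 - w + 1) + y ^ 2 * (w ^ 4 - w ^ 3 + w ^ 2) - y ^ 3 * (w - 1) * (w ^ 3 + 1)) * hw
  have e1 := pr 1 (Or.inl rfl)
  have e2 := pr 2 (Or.inr rfl)
  have k0 := key q hq
  have k1 := key _ hw1
  have k2 := key _ hw2
  have k3 := key _ h3
  rw [mul_pow, w3, one_mul] at k1
  rw [mul_pow, show (w ^ 2) ^ 3 = (w ^ 3) ^ 2 by ring, w3, one_pow, one_mul] at k2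
  rw [← pow_mul] at k3
  norm_num at k3
  rw [← e1, ← e2] at k3
  rw [k0, k1, k2, show E (q ^ 3) ^ 4 = E (q ^ 3) ^ 3 * E (q ^ 3) by ring]
  nth_rewrite 5 [k3]
  ring

end RF

namespace RF
open Filter Topology

lemma summable_quad {q : ℂ} (hq0 : q ≠ 0) (hq : ‖q‖ < 1) {a : ℕ} (ha : a ≠ 0) (b : ℤ) :
    Summable fun n : ℤ => q ^ (a * n ^ 2 + b * n) := by
  refine (summable_theta (pow_ne_zero a hq0) (norm_pow_lt hq ha) (zpow_ne_zero b hq0)).congr fun n => ?_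
  rw [zpow_add₀ hq0, zpow_mul, zpow_mul, zpow_natCast]

lemma summable_phi {q : ℂ} (hq0 : q ≠ 0) (hq : ‖q‖ < 1) : Summable fun n : ℤ => q ^ (n ^ 2) := by
  simpa using summable_quad hq0 hq one_ne_zero 0

lemma hasSum_phi {q : ℂ} (hq0 : q ≠ 0) (hq : ‖q‖ < 1) : HasSum (fun n : ℤ => q ^ (n ^ 2)) (phi q) :=
  (summable_phi hq0 hq).hasSum

lemma hasSum_psi {q : ℂ} (hq0 : q ≠ 0) (hq : ‖q‖ < 1) :
    HasSum (fun n : ℤ => q ^ (2 * n ^ 2 - n)) (psi q) := by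
  refine Summable.hasSum ?_
  simpa [sub_eq_add_neg] using summable_quad hq0 hq two_ne_zero (-1)

lemma hasSum_tri {q : ℂ} (hq0 : q ≠ 0) (hq : ‖q‖ < 1) :
    HasSum (fun n : ℤ => q ^ (3 * n ^ 2 - 2 * n)) (tri q) := by
  refine Summable.hasSum ?_
  simpa [sub_eq_add_neg] using summable_quad hq0 hq three_ne_zero (-2)

lemma pz (q : ℂ) (k : ℕ) (n : ℤ) : (q ^ k) ^ n = q ^ (k * n) := by
  rw [zpow_mul, zpow_natCast]

lemma int_even_odd {f : ℤ → ℂ} {a b : ℂ} (h0 : HasSum (fun k : ℤ => f (2 * k)) a)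
    (h1 : HasSum (fun k : ℤ => f (2 * k + 1)) b) : HasSum f (a + b) := by
  have i0 : Function.Injective (fun k : ℤ => 2 * k) := fun x y h => by simpa using h
  have i1 : Function.Injective (fun k : ℤ => 2 * k + 1) := fun x y h => by simpa using h
  refine HasSum.add_isCompl ?_ (i0.hasSum_range_iff.mpr h0) (i1.hasSum_range_iff.mpr h1)
  refine isCompl_iff.mpr ⟨?_, ?_⟩
  · rw [Set.disjoint_left]
    rintro _ ⟨x, rfl⟩ ⟨y, h⟩
    simp only at h; omega
  · rw [codisjoint_iff_le_sup]
    intro x _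
    rcases Int.emod_two_eq_zero_or_one x with h | h
    · left; exact ⟨x / 2, by simp only; omega⟩
    · right; exact ⟨x / 2, by simp only; omega⟩

lemma D1 {q : ℂ} (hq0 : q ≠ 0) (hq : ‖q‖ < 1) : phi q = phi (q ^ 4) + 2 * q * psi (q ^ 8) := by
  have h4 := hasSum_phi (pow_ne_zero 4 hq0) (norm_pow_lt hq four_ne_zero)
  have h8 := hasSum_psi (pow_ne_zero 8 hq0) (norm_pow_lt hq (k := 8) (by norm_num))
  have ha : HasSum (fun k : ℤ => q ^ ((2 * k) ^ 2)) (phi (q ^ 4)) := by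
    refine HasSum.congr_fun' h4 (fun j => ?_) rfl
    rw [pz]; congr 1; push_cast; ring
  have h8' : HasSum (fun k : ℤ => q ^ ((2 * (2 * k + 1) + 1) ^ 2)) (q * psi (q ^ 8)) := by
    refine HasSum.congr_fun' (((Equiv.addRight (1 : ℤ)).hasSum_iff.mpr h8).mul_left q) (fun j => ?_) rfl
    simp only [Function.comp, Equiv.coe_addRight]
    rw [pz, ← zpow_one_add₀ hq0]; congr 1; push_cast; ring
  have h8'' : HasSum (fun k : ℤ => q ^ ((2 * (2 * k) + 1) ^ 2)) (q * psi (q ^ 8)) := by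
    refine HasSum.congr_fun' (((Equiv.neg ℤ).hasSum_iff.mpr h8).mul_left q) (fun j => ?_) rfl
    simp only [Function.comp, Equiv.neg_apply]
    rw [pz, ← zpow_one_add₀ hq0]; congr 1; push_cast; ring
  have := int_even_odd (f := fun k : ℤ => q ^ (k ^ 2)) ha (int_even_odd (f := fun k : ℤ => q ^ ((2 * k + 1) ^ 2)) h8'' h8')
  rw [(hasSum_phi hq0 hq).unique this]; ring

lemma D4 {q : ℂ} (hq0 : q ≠ 0) (hq : ‖q‖ < 1) : phi q = phi (q ^ 9) + 2 * q * tri (q ^ 3) := by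
  have h9 := hasSum_phi (pow_ne_zero 9 hq0) (norm_pow_lt hq (k := 9) (by norm_num))
  have h3 := hasSum_tri (pow_ne_zero 3 hq0) (norm_pow_lt hq three_ne_zero)
  have s := (Int.divModEquiv 3).symm.summable_iff.mpr (summable_phi hq0 hq)
  have e := (Int.divModEquiv 3).symm.tsum_eq (fun n : ℤ => q ^ (n ^ 2))
  have s' := (Equiv.prodComm (Fin 3) ℤ).summable_iff.mpr s
  have e' := (Equiv.prodComm (Fin 3) ℤ).tsum_eq ((fun n : ℤ => q ^ (n ^ 2)) ∘ (Int.divModEquiv 3).symm)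
  have e2 := s'.tsum_prod
  rw [phi, ← e]
  refine e'.symm.trans (e2.trans ?_)
  rw [tsum_fintype, Fin.sum_univ_three]
  simp only [Function.comp, Equiv.prodComm_apply, Prod.swap, Int.divModEquiv_symm_apply]
  have a0 : ∑' c : ℤ, q ^ ((c * 3 + ((0 : Fin 3) : ℕ) : ℤ) ^ 2) = phi (q ^ 9) := by
    refine HasSum.tsum_eq (HasSum.congr_fun' h9 (fun j => ?_) rfl)
    rw [pz]; congr 1; push_cast; simp; ring
  have a1 : ∑' c : ℤ, q ^ ((c * 3 + ((1 : Fin 3) : ℕ) : ℤ) ^ 2) = q * tri (q ^ 3) := by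
    refine HasSum.tsum_eq (HasSum.congr_fun' (((Equiv.neg ℤ).hasSum_iff.mpr h3).mul_left q) (fun j => ?_) rfl)
    simp only [Function.comp, Equiv.neg_apply]
    rw [pz, ← zpow_one_add₀ hq0]; congr 1; push_cast; simp; ring
  have a2 : ∑' c : ℤ, q ^ ((c * 3 + ((2 : Fin 3) : ℕ) : ℤ) ^ 2) = q * tri (q ^ 3) := by
    refine HasSum.tsum_eq (HasSum.congr_fun' (((Equiv.addRight (1 : ℤ)).hasSum_iff.mpr h3).mul_left q) (fun j => ?_) rfl)
    simp only [Function.comp, Equiv.coe_addRight]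
    rw [pz, ← zpow_one_add₀ hq0]; congr 1; push_cast; simp; ring
  push_cast at a0 a1 a2 ⊢
  rw [a0, a1, a2]; ring

lemma prodSum {f g : ℤ → ℂ} {a b : ℂ} (hf : HasSum f a) (hg : HasSum g b) :
    HasSum (fun p : ℤ × ℤ => f p.1 * g p.2) (a * b) :=
  hf.mul hg (summable_mul_of_summable_norm hf.summable.norm hg.summable.norm)

lemma neg_zp (q : ℂ) (n : ℤ) : (-q) ^ n = (-1) ^ n * q ^ n := by
  rw [← mul_zpow]; simp

lemma D2 {q : ℂ} (hq0 : q ≠ 0) (hq : ‖q‖ < 1) : phi q ^ 2 + phi (-q) ^ 2 = 2 * phi (q ^ 2) ^ 2 := by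
  have h1 := hasSum_phi hq0 hq
  have h2 := hasSum_phi (neg_ne_zero.mpr hq0) (by simpa using hq)
  have h3 := hasSum_phi (pow_ne_zero 2 hq0) (norm_pow_lt hq two_ne_zero)
  have s := (prodSum h1 h1).add (prodSum h2 h2)
  have t := (prodSum h3 h3).mul_left 2
  have inj : Function.Injective (fun p : ℤ × ℤ => (p.1 + p.2, p.1 - p.2)) := by
    rintro ⟨a, b⟩ ⟨c, d⟩ h
    simp only [Prod.mk.injEq] at h ⊢
    omega
  have key := inj.tsum_eq (f := fun b : ℤ × ℤ => q ^ b.1 ^ 2 * q ^ b.2 ^ 2 + (-q) ^ b.1 ^ 2 * (-q) ^ b.2 ^ 2) ?_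
  · rw [s.tsum_eq] at key
    rw [sq, sq, ← key, sq, ← t.tsum_eq]
    congr 1; funext p
    have hq' := neg_ne_zero.mpr hq0
    rw [← zpow_add₀ hq0, ← zpow_add₀ hq', pz, pz, ← zpow_add₀ hq0]
    have e : (p.1 + p.2) ^ 2 + (p.1 - p.2) ^ 2 = ((2:ℕ):ℤ) * p.1 ^ 2 + ((2:ℕ):ℤ) * p.2 ^ 2 := by push_cast; ring
    rw [e, Even.neg_zpow ⟨p.1 ^ 2 + p.2 ^ 2, by push_cast; ring⟩]; ring
  · rintro ⟨a, b⟩ h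
    have hev : Even (a + b) := by
      by_contra ho
      rw [Int.not_even_iff_odd] at ho
      apply h
      simp only
      rw [← zpow_add₀ hq0, ← zpow_add₀ (neg_ne_zero.mpr hq0)]
      have : Odd (a ^ 2 + b ^ 2) := by
        rw [show a ^ 2 + b ^ 2 = (a + b) ^ 2 - 2 * (a * b) by ring]
        exact (ho.pow).sub_even (even_two_mul _)
      rw [Odd.neg_zpow this]; ring
    obtain ⟨c, hc⟩ := hev
    exact ⟨(c, a - c), by simp only [Prod.mk.injEq]; omega⟩

lemma D3 {q : ℂ} (hq0 : q ≠ 0) (hq : ‖q‖ < 1) :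
    phi q * phi (q ^ 3) - phi (-q) * phi (-q ^ 3) = 4 * q * psi (q ^ 2) * psi (q ^ 6) := by
  have hq3 := norm_pow_lt hq three_ne_zero
  have hq03 := pow_ne_zero 3 hq0
  have h1 := hasSum_phi hq0 hq
  have h2 := hasSum_phi (neg_ne_zero.mpr hq0) (by simpa using hq)
  have h13 := hasSum_phi hq03 hq3
  have h23 := hasSum_phi (neg_ne_zero.mpr hq03) (by simpa using hq3)
  have k2 := hasSum_psi (pow_ne_zero 2 hq0) (norm_pow_lt hq two_ne_zero)
  have k6 := hasSum_psi (pow_ne_zero 6 hq0) (norm_pow_lt hq (k := 6) (by norm_num))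
  have s := (prodSum h1 h13).sub (prodSum h2 h23)
  have t := (prodSum k2 k6).mul_left q
  set H : ℤ × ℤ → ℂ := fun p => if (p.1 + p.2) % 4 = 3 then q ^ (p.1 ^ 2 + 3 * p.2 ^ 2) else 0 with hH
  have inj : Function.Injective (fun p : ℤ × ℤ => (p.1 + 3 * p.2 - 1, p.2 - p.1)) := by
    rintro ⟨a, b⟩ ⟨c, d⟩ h
    simp only [Prod.mk.injEq] at h ⊢
    omega
  have hs : Function.support H ⊆ Set.range (fun p : ℤ × ℤ => (p.1 + 3 * p.2 - 1, p.2 - p.1)) := by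
    rintro ⟨a, b⟩ h
    have : (a + b) % 4 = 3 := by
      by_contra hc; apply h; simp [hH, hc]
    exact ⟨((a + b + 1) / 4 - b, (a + b + 1) / 4), by simp only [Prod.mk.injEq]; omega⟩
  have hs' : ∀ x ∉ Set.range (fun p : ℤ × ℤ => (p.1 + 3 * p.2 - 1, p.2 - p.1)), H x = 0 := by
    intro x hx
    by_contra hc
    exact hx (hs hc)
  have hHs : HasSum H (q * (psi (q ^ 2) * psi (q ^ 6))) := by
    rw [← inj.hasSum_iff hs']
    have e : (H ∘ fun p : ℤ × ℤ => (p.1 + 3 * p.2 - 1, p.2 - p.1)) =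
        fun i : ℤ × ℤ => q * ((q ^ 2) ^ (2 * i.1 ^ 2 - i.1) * (q ^ 6) ^ (2 * i.2 ^ 2 - i.2)) := by
      funext p
      simp only [Function.comp, hH]
      rw [if_pos (by omega), pz, pz, ← zpow_add₀ hq0, ← zpow_one_add₀ hq0]
      congr 1; push_cast; ring
    rw [e]; exact t
  have hHn := (Equiv.neg (ℤ × ℤ)).hasSum_iff.mpr hHs
  have tot := (hHs.add hHn).mul_left 2
  have e : (fun b : ℤ × ℤ => q ^ b.1 ^ 2 * (q ^ 3) ^ b.2 ^ 2 - (-q) ^ b.1 ^ 2 * (-q ^ 3) ^ b.2 ^ 2) =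
      fun i => 2 * (H i + (H ∘ (Equiv.neg (ℤ × ℤ))) i) := by
    funext p
    obtain ⟨a, b⟩ := p
    simp only [Function.comp, hH, Equiv.neg_apply, Prod.fst_neg, Prod.snd_neg]
    rw [neg_zp q, neg_zp (q ^ 3), pz, mul_mul_mul_comm, ← zpow_add₀ hq0, ← zpow_add₀ (by norm_num), neg_sq, neg_sq]
    push_cast
    by_cases ho : Even (a + b)
    · have : Even (a ^ 2 + b ^ 2) := by
        rw [show a ^ 2 + b ^ 2 = (a + b) ^ 2 - 2 * (a * b) by ring]
        exact (ho.pow_of_ne_zero two_ne_zero).sub (even_two_mul _)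
      rw [this.neg_zpow]
      obtain ⟨c, hc⟩ := ho
      rw [if_neg (by omega), if_neg (by omega)]; simp
    · rw [Int.not_even_iff_odd] at ho
      have : Odd (a ^ 2 + b ^ 2) := by
        rw [show a ^ 2 + b ^ 2 = (a + b) ^ 2 - 2 * (a * b) by ring]
        exact (ho.pow).sub_even (even_two_mul _)
      rw [this.neg_zpow]
      obtain ⟨c, hc⟩ := ho
      rcases Int.emod_two_eq_zero_or_one c with h | h
      · rw [if_neg (by omega), if_pos (by omega)]; simp; ring
      · rw [if_pos (by omega), if_neg (by omega)]; simp; ring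
  rw [e] at s
  rw [s.unique tot]; ring

end RF

namespace RF
open Filter Topology

lemma exists_omega : ∃ w : ℂ, w ^ 2 + w + 1 = 0 := by
  obtain ⟨s, hs⟩ := IsAlgClosed.exists_pow_nat_eq (-3 : ℂ) (n := 2) (by norm_num)
  exact ⟨(-1 + s) / 2, by linear_combination hs / 4⟩

lemma D5cube {q : ℂ} (hq0 : q ≠ 0) (hq : ‖q‖ < 1) :
    phi (q ^ 9) * (phi (q ^ 9) ^ 3 + 8 * q ^ 3 * tri (q ^ 3) ^ 3) = phi (q ^ 3) ^ 4 := by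
  obtain ⟨w, hw⟩ := exists_omega
  have w3 : w ^ 3 = 1 := by linear_combination (w - 1) * hw
  have w0 : w ≠ 0 := by rintro rfl; norm_num at w3
  have nw : ‖w‖ = 1 := by
    have : ‖w‖ ^ 3 = 1 := by rw [← norm_pow, w3, norm_one]
    exact (pow_eq_one_iff_of_nonneg (norm_nonneg _) three_ne_zero).mp this
  have hw' : (w ^ 2) ^ 2 + w ^ 2 + 1 = 0 := by linear_combination (w ^ 2 - w + 1) * hw
  have hw1 : ‖w * q‖ < 1 := by rw [norm_mul, nw, one_mul]; exact hq
  have hw2 : ‖w ^ 2 * q‖ < 1 := by rw [norm_mul, norm_pow, nw, one_pow, one_mul]; exact hq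
  have w4 : w ^ 4 = w := by linear_combination w * w3
  have w8 : w ^ 8 = w ^ 2 := by linear_combination w ^ 2 * (w ^ 3 + 1) * w3
  have w6 : w ^ 6 = 1 := by linear_combination (w ^ 3 + 1) * w3
  have w9 : w ^ 9 = 1 := by linear_combination (w ^ 6 + w ^ 3 + 1) * w3
  have w18 : w ^ 18 = 1 := by linear_combination (w ^ 9 + 1) * w9
  have a0 := D4 hq0 hq
  have a1 := D4 (mul_ne_zero w0 hq0) hw1
  have a2 := D4 (mul_ne_zero (pow_ne_zero 2 w0) hq0) hw2
  rw [mul_pow, mul_pow, w9, w3, one_mul, one_mul] at a1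
  rw [mul_pow, mul_pow, ← pow_mul, ← pow_mul, w18, w6, one_mul, one_mul] at a2
  have b0 := phi_eq hq0 hq
  have b1 := phi_eq (mul_ne_zero w0 hq0) hw1
  have b2 := phi_eq (mul_ne_zero (pow_ne_zero 2 w0) hq0) hw2
  rw [mul_pow, mul_pow, w4] at b1
  rw [mul_pow, mul_pow, ← pow_mul, ← pow_mul, w4, w8] at b2
  have c1 := E_omega hq hw
  have c2 := E_omega (norm_pow_lt hq two_ne_zero) hw
  have c4 := E_omega (norm_pow_lt hq four_ne_zero) hw
  have d3 := phi_eq (pow_ne_zero 3 hq0) (norm_pow_lt hq three_ne_zero)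
  have d9 := phi_eq (pow_ne_zero 9 hq0) (norm_pow_lt hq (k := 9) (by norm_num))
  simp only [← pow_mul, Nat.reduceMul] at c2 c4 d3 d9
  have n1 := E_ne hq
  have nn : ∀ k, k ≠ 0 → E (q ^ k) ≠ 0 := fun k hk => E_ne (norm_pow_lt hq hk)
  have n2 := nn 2 (by norm_num)
  have n4 := nn 4 (by norm_num)
  have n3 := nn 3 (by norm_num)
  have n6 := nn 6 (by norm_num)
  have n9 := nn 9 (by norm_num)
  have n12 := nn 12 (by norm_num)
  have n18 := nn 18 (by norm_num)
  have n36 := nn 36 (by norm_num)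
  have nw1 := E_ne hw1
  have nw2 := E_ne hw2
  have m2 : ∀ j k : ℕ, k ≠ 0 → E (w ^ j * q ^ k) ≠ 0 := by
    intro j k hk
    apply E_ne
    rw [norm_mul, norm_pow, nw, one_pow, one_mul]; exact norm_pow_lt hq hk
  have m12 := m2 1 2 (by norm_num)
  have m14 := m2 1 4 (by norm_num)
  have m22 := m2 2 2 (by norm_num)
  have m24 := m2 2 4 (by norm_num)
  rw [pow_one] at m12 m14
  have pr : phi q * phi (w * q) * phi (w ^ 2 * q) = phi (q ^ 9) ^ 3 + 8 * q ^ 3 * tri (q ^ 3) ^ 3 := by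
    rw [a0, a1, a2]
    generalize phi (q ^ 9) = a
    generalize tri (q ^ 3) = t
    linear_combination (8 * q ^ 3 * t ^ 3 * (w - 1) + 2 * a ^ 2 * q * t + 4 * q ^ 2 * t ^ 2 * a * w) * hw
  rw [← pr, b0, b1, b2, d3, d9]
  generalize E (q ^ 3) = e3 at *
  generalize E (q ^ 6) = e6 at *
  generalize E (q ^ 12) = e12 at *
  generalize E (w * q) = f1 at *
  generalize E (w ^ 2 * q) = g1 at *
  generalize E (w * q ^ 2) = f2 at *
  generalize E (w ^ 2 * q ^ 2) = g2 at *
  generalize E (w * q ^ 4) = f4 at *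
  generalize E (w ^ 2 * q ^ 4) = g4 at *
  generalize E (q ^ 9) = e9 at *
  generalize E (q ^ 18) = e18 at *
  generalize E (q ^ 36) = e36 at *
  generalize E (q ^ 2) = e2 at *
  generalize E (q ^ 4) = e4 at *
  generalize E q = e1 at *
  have : e18 ^ 5 / (e9 ^ 2 * e36 ^ 2) * (e2 ^ 5 / (e1 ^ 2 * e4 ^ 2) * (f2 ^ 5 / (f1 ^ 2 * g4 ^ 2))* (g2 ^ 5 / (g1 ^ 2 * f4 ^ 2)))
     = (e2 * f2 * g2 * e18) ^ 5 / ((e1 * f1 * g1 * e9) ^ 2 * (e4 * f4 * g4 * e36) ^ 2) := by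
    field_simp
  rw [c1, c2, c4] at this
  rw [div_pow]
  convert this using 1
  · ring
  · ring

lemma D5 {q : ℂ} (hq0 : q ≠ 0) (hq : ‖q‖ < 1) :
    phi q ^ 4 = phi (q ^ 3) ^ 4 + 8 * q * phi (q ^ 3) * tri q ^ 3 := by
  obtain ⟨p, rfl⟩ := IsAlgClosed.exists_pow_nat_eq q (n := 3) (by norm_num)
  have hp0 : p ≠ 0 := by rintro rfl; simp at hq0
  have hp : ‖p‖ < 1 := by
    rw [norm_pow] at hq
    by_contra h
    exact absurd hq (not_lt.mpr (one_le_pow₀ (not_lt.mp h)))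
  rw [← D5cube hp0 hp, ← pow_mul]; ring

lemma D5neg {q : ℂ} (hq0 : q ≠ 0) (hq : ‖q‖ < 1) :
    phi (-q) ^ 4 = phi (-q ^ 3) ^ 4 - 8 * q * phi (-q ^ 3) * tri (-q) ^ 3 := by
  have := D5 (neg_ne_zero.mpr hq0) (by simpa using hq)
  rw [Odd.neg_pow (by decide)] at this
  rw [this]; ring

lemma tri_neg_eq {q : ℂ} (hq0 : q ≠ 0) (hq : ‖q‖ < 1) :
    tri (-q) = E (q ^ 6) ^ 2 * E q / (E (q ^ 3) * E (q ^ 2)) := by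
  have h := tri_eq (neg_ne_zero.mpr hq0) (by simpa using hq)
  have e3 := E_neg (norm_pow_lt hq three_ne_zero)
  rw [E_neg hq, Odd.neg_pow (n := 3) (by decide), e3, Even.neg_pow (n := 2) (by decide),
    Even.neg_pow (n := 4) (by decide), Even.neg_pow (n := 6) (by decide), Even.neg_pow (n := 12) (by decide)] at h
  simp only [← pow_mul, Nat.reduceMul] at h
  have n1 := E_ne hq
  have nn : ∀ k, k ≠ 0 → E (q ^ k) ≠ 0 := fun k hk => E_ne (norm_pow_lt hq hk)
  have n2 := nn 2 (by norm_num)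
  have n4 := nn 4 (by norm_num)
  have n3 := nn 3 (by norm_num)
  have n6 := nn 6 (by norm_num)
  have n12 := nn 12 (by norm_num)
  rw [h]; field_simp

lemma D1neg {q : ℂ} (hq0 : q ≠ 0) (hq : ‖q‖ < 1) : phi (-q) = phi (q ^ 4) - 2 * q * psi (q ^ 8) := by
  have := D1 (neg_ne_zero.mpr hq0) (by simpa using hq)
  rw [this, Even.neg_pow (by decide), Even.neg_pow (by decide)]; ring

lemma phi_psi {q : ℂ} (hq0 : q ≠ 0) (hq : ‖q‖ < 1) : phi q * psi (q ^ 2) = psi q ^ 2 := by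
  have n1 := E_ne hq
  have n2 := E_ne (norm_pow_lt hq two_ne_zero)
  have n4 := E_ne (norm_pow_lt hq four_ne_zero)
  rw [phi_eq hq0 hq, psi_eq hq0 hq, psi_eq (pow_ne_zero 2 hq0) (norm_pow_lt hq two_ne_zero), ← pow_mul]
  norm_num
  field_simp

lemma sq_diff {q : ℂ} (hq0 : q ≠ 0) (hq : ‖q‖ < 1) :
    phi q ^ 2 - phi (-q) ^ 2 = 8 * q * psi (q ^ 4) ^ 2 := by
  have := phi_psi (pow_ne_zero 4 hq0) (norm_pow_lt hq four_ne_zero)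
  rw [← pow_mul] at this
  norm_num at this
  rw [D1 hq0 hq, D1neg hq0 hq, ← this]; ring

lemma quartic {q : ℂ} (hq0 : q ≠ 0) (hq : ‖q‖ < 1) :
    phi q ^ 4 - phi (-q) ^ 4 = 16 * q * psi (q ^ 2) ^ 4 := by
  have := phi_psi (pow_ne_zero 2 hq0) (norm_pow_lt hq two_ne_zero)
  rw [← pow_mul] at this
  norm_num at this
  rw [show psi (q ^ 2) ^ 4 = (psi (q ^ 2) ^ 2) ^ 2 by ring, ← this]
  linear_combination (phi q ^ 2 + phi (-q) ^ 2) * sq_diff hq0 hq + 8 * q * psi (q ^ 4) ^ 2 * D2 hq0 hq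

lemma mul_neg_phi {q : ℂ} (hq0 : q ≠ 0) (hq : ‖q‖ < 1) : phi (-q ^ 2) ^ 2 = phi q * phi (-q) := by
  have n1 := E_ne hq
  have n2 := E_ne (norm_pow_lt hq two_ne_zero)
  have n4 := E_ne (norm_pow_lt hq four_ne_zero)
  rw [phi_eq hq0 hq, phi_neg_eq hq0 hq, phi_neg_eq (pow_ne_zero 2 hq0) (norm_pow_lt hq two_ne_zero), ← pow_mul]
  norm_num
  field_simp

lemma E_zero : E 0 = 1 := by simp [E]

lemma E_cont : ContinuousAt E 0 := by
  have := ModularForm.differentiableOn_tprod_one_sub_pow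
  exact (this.differentiableAt (Metric.ball_mem_nhds 0 one_pos)).continuousAt

lemma E_tendsto {k : ℕ} (hk : k ≠ 0) : Tendsto (fun q : ℂ => E (q ^ k)) (𝓝[≠] 0) (𝓝 1) := by
  have : Tendsto (fun q : ℂ => q ^ k) (𝓝[≠] 0) (𝓝 0) := by
    have h := (continuous_pow k : Continuous fun q : ℂ => q ^ k).tendsto 0
    rw [zero_pow hk] at h
    exact h.mono_left nhdsWithin_le_nhds
  rw [← E_zero]
  exact E_cont.tendsto.comp this

end RF

namespace RF
open Filter Topology

noncomputable def Pf (q : ℂ) : ℂ :=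
  2 * q * E (q ^ 12) ^ 6 * E (q ^ 2) ^ 3 * E (q ^ 3) ^ 3 / (E (q ^ 6) ^ 9 * E q * E (q ^ 4) ^ 2)
noncomputable def Qf (q : ℂ) : ℂ :=
  E (q ^ 3) ^ 6 * E (q ^ 12) ^ 3 * E (q ^ 2) ^ 3 / (E (q ^ 6) ^ 9 * E q ^ 2 * E (q ^ 4))

lemma ev_small : ∀ᶠ q : ℂ in 𝓝[≠] 0, q ≠ 0 ∧ ‖q‖ < 1 := by
  have h1 : ∀ᶠ q : ℂ in 𝓝[≠] 0, ‖q‖ < 1 := by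
    apply eventually_nhdsWithin_of_eventually_nhds
    have := Metric.ball_mem_nhds (0 : ℂ) one_pos
    filter_upwards [this] with q hq
    simpa using hq
  filter_upwards [h1, self_mem_nhdsWithin] with q h h'
  exact ⟨h', h⟩

lemma pow_tendsto {k : ℕ} (hk : k ≠ 0) : Tendsto (fun q : ℂ => q ^ k) (𝓝[≠] 0) (𝓝[≠] 0) := by
  refine tendsto_nhdsWithin_iff.mpr ⟨?_, ?_⟩
  · have h := (continuous_pow k : Continuous fun q : ℂ => q ^ k).tendsto 0
    rw [zero_pow hk] at h
    exact h.mono_left nhdsWithin_le_nhds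
  · filter_upwards [self_mem_nhdsWithin] with q h
    exact pow_ne_zero k h

lemma neg_tendsto : Tendsto (fun q : ℂ => -q) (𝓝[≠] 0) (𝓝[≠] 0) := by
  refine tendsto_nhdsWithin_iff.mpr ⟨?_, ?_⟩
  · have h := (continuous_neg : Continuous fun q : ℂ => -q).tendsto 0
    rw [neg_zero] at h
    exact h.mono_left nhdsWithin_le_nhds
  · filter_upwards [self_mem_nhdsWithin] with q h
    exact neg_ne_zero.mpr h

lemma E_tendsto1 : Tendsto E (𝓝[≠] 0) (𝓝 1) := by
  simpa using E_tendsto one_ne_zero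

lemma id_tendsto : Tendsto (fun q : ℂ => q) (𝓝[≠] 0) (𝓝 0) := tendsto_id.mono_left nhdsWithin_le_nhds

lemma phi_tendsto : Tendsto phi (𝓝[≠] 0) (𝓝 1) := by
  have h := ((E_tendsto two_ne_zero).pow 5).div
    (((E_tendsto1).pow 2).mul ((E_tendsto four_ne_zero).pow 2)) (by norm_num)
  norm_num at h
  refine h.congr' ?_
  filter_upwards [ev_small] with q hq
  exact (phi_eq hq.1 hq.2).symm

lemma Pf_tendsto : Tendsto Pf (𝓝[≠] 0) (𝓝 0) := by
  have h := ((((id_tendsto.const_mul 2).mul ((E_tendsto (k := 12) (by norm_num)).pow 6)).mul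
    ((E_tendsto (k := 2) (by norm_num)).pow 3)).mul ((E_tendsto (k := 3) (by norm_num)).pow 3)).div
    (((((E_tendsto (k := 6) (by norm_num)).pow 9).mul E_tendsto1)).mul ((E_tendsto four_ne_zero).pow 2)) (by norm_num)
  norm_num at h
  exact h

lemma Qf_tendsto : Tendsto Qf (𝓝[≠] 0) (𝓝 1) := by
  have h := ((((E_tendsto (k := 3) (by norm_num)).pow 6).mul ((E_tendsto (k := 12) (by norm_num)).pow 3)).mul
    ((E_tendsto (k := 2) (by norm_num)).pow 3)).div
    (((((E_tendsto (k := 6) (by norm_num)).pow 9).mul (E_tendsto1.pow 2))).mul ((E_tendsto four_ne_zero))) (by norm_num)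
  norm_num at h
  exact h

lemma phi_ne {q : ℂ} (hq0 : q ≠ 0) (hq : ‖q‖ < 1) : phi q ≠ 0 := by
  rw [phi_eq hq0 hq]
  have n1 := E_ne hq
  have n2 := E_ne (norm_pow_lt hq two_ne_zero)
  have n4 := E_ne (norm_pow_lt hq four_ne_zero)
  positivity

structure Basic (q A B C D P Q : ℂ) : Prop where
  A0 : A ≠ 0
  B0 : B ≠ 0
  C0 : C ≠ 0
  D0 : D ≠ 0
  Q0 : Q ≠ 0
  f1 : A ^ 4 = B ^ 4 * (1 + 4 * P * Q)
  f2 : C ^ 4 * Q ^ 2 = D ^ 4 * (Q ^ 2 - 4 * P)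
  f3 : D ^ 4 * (A * B) = B ^ 4 * Q ^ 2 * (C * D)
  f4 : (B ^ 4 - D ^ 4) * (A * B) = B ^ 4 * P ^ 2 * (A * B - C * D)
  f5 : C ^ 4 * B ^ 4 * Q ^ 4 * A ^ 2 * B ^ 2 = D ^ 4 * A ^ 4 * C ^ 2 * D ^ 2

lemma basic {q : ℂ} (hq0 : q ≠ 0) (hq : ‖q‖ < 1) :
    Basic q (phi q) (phi (q ^ 3)) (phi (-q)) (phi (-q ^ 3)) (Pf q) (Qf q) := by
  have hq3 := norm_pow_lt hq three_ne_zero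
  have hq03 := pow_ne_zero 3 hq0
  have n1 := E_ne hq
  have nn : ∀ k, k ≠ 0 → E (q ^ k) ≠ 0 := fun k hk => E_ne (norm_pow_lt hq hk)
  have n2 := nn 2 (by norm_num)
  have n4 := nn 4 (by norm_num)
  have n3 := nn 3 (by norm_num)
  have n6 := nn 6 (by norm_num)
  have n12 := nn 12 (by norm_num)
  have hA := phi_eq hq0 hq
  have hB := phi_eq hq03 hq3
  have hC := phi_neg_eq hq0 hq
  have hD := phi_neg_eq hq03 hq3
  have ht := tri_eq hq0 hq
  have ht' := tri_neg_eq hq0 hq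
  have p2 := psi_eq (pow_ne_zero 2 hq0) (norm_pow_lt hq two_ne_zero)
  have p6 := psi_eq (pow_ne_zero 6 hq0) (norm_pow_lt hq (k := 6) (by norm_num))
  have d5 := D5 hq0 hq
  have d5' := D5neg hq0 hq
  have d3 := D3 hq0 hq
  have qq := quartic hq03 hq3
  simp only [← pow_mul, Nat.reduceMul] at hB hD p2 p6 qq
  refine ⟨phi_ne hq0 hq, phi_ne hq03 hq3, phi_ne (neg_ne_zero.mpr hq0) (by simpa using hq),
    phi_ne (neg_ne_zero.mpr hq03) (by simpa using hq3), ?_, ?_, ?_, ?_, ?_, ?_⟩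
  · unfold Qf; positivity
  · rw [d5, ht, hB]; unfold Pf Qf; field_simp; ring
  · rw [d5', ht', hD]; unfold Pf Qf; field_simp; ring
  · rw [hA, hB, hC, hD]; unfold Qf; field_simp
  · rw [d3, qq, p2, p6, hA, hB]; unfold Pf; field_simp; ring
  · rw [hA, hB, hC, hD]; unfold Qf; field_simp

lemma Basic.rel {q A B C D P Q : ℂ} (b : Basic q A B C D P Q) :
    C * D * (Q ^ 2 - P ^ 2) = A * B * (1 - P ^ 2) ∧
    (1 + 4 * P * Q) * (1 - P ^ 2) ^ 2 = (Q ^ 2 - 4 * P) * Q ^ 2 * (Q ^ 2 - P ^ 2) ^ 2 := by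
  obtain ⟨A0, B0, C0, D0, Q0, f1, f2, f3, f4, f5⟩ := b
  have h1 : C * D * (Q ^ 2 - P ^ 2) = A * B * (1 - P ^ 2) := by
    apply mul_left_cancel₀ (pow_ne_zero 4 B0)
    linear_combination -f4 - f3
  refine ⟨h1, ?_⟩
  -- C^4/D^4 computations
  have h2 : (Q ^ 2 - 4 * P) * Q ^ 2 * (A * B) ^ 2 = (1 + 4 * P * Q) * (C * D) ^ 2 := by
    apply mul_left_cancel₀ (mul_ne_zero (pow_ne_zero 4 B0) (pow_ne_zero 4 D0))
    linear_combination f5 + D ^ 4 * (C * D) ^ 2 * f1 - B ^ 4 * Q ^ 2 * A ^ 2 * B ^ 2 * f2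
  apply mul_left_cancel₀ (pow_ne_zero 2 (mul_ne_zero A0 B0))
  linear_combination -(1 + 4 * P * Q) * (A * B * (1 - P ^ 2) + C * D * (Q ^ 2 - P ^ 2)) * h1 - (Q ^ 2 - P ^ 2) ^ 2 * h2

lemma ev_QP : ∀ᶠ q : ℂ in 𝓝[≠] 0, Qf q = 1 + Pf q := by
  set K : ℂ × ℂ → ℂ := fun x => (1) * x.1^1 * x.2^0 + (-1) * x.1^3 * x.2^0 + (1) * x.1^2 * x.2^0 + (-1) * x.1^0 * x.2^0 + (3) * x.1^2 * x.2^1 + (-1) * x.1^0 * x.2^1 + (-4) * x.1^4 * x.2^1 + (-2) * x.1^1 * x.2^1 + (4) * x.1^3 * x.2^1 + (4) * x.1^2 * x.2^2 + (-1) * x.1^0 * x.2^2 + (-4) * x.1^4 * x.2^2 + (-1) * x.1^1 * x.2^2 + (-4) * x.1^3 * x.2^3 + (4) * x.1^2 * x.2^3 + (-1) * x.1^0 * x.2^3 + (3) * x.1^2 * x.2^4 + (1) * x.1^1 * x.2^4 + (-1) * x.1^0 * x.2^4 + (1) * x.1^3 * x.2^4 + (1) * x.1^2 * x.2^5 + (2)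 * x.1^1 * x.2^5 + (-1) * x.1^0 * x.2^5 + (-1) * x.1^0 * x.2^6 + (-1) * x.1^1 * x.2^6 + (-1) * x.1^0 * x.2^7 with hK
  have Kc : Continuous K := by rw [hK]; fun_prop
  have kt : Tendsto (fun q => K (Pf q, Qf q)) (𝓝[≠] 0) (𝓝 (K (0, 1))) :=
    (Kc.tendsto (0, 1)).comp (Pf_tendsto.prodMk_nhds Qf_tendsto)
  have kn : K (0, 1) ≠ 0 := by simp [hK]; norm_num
  filter_upwards [ev_small, kt.eventually_ne kn] with q hq hk
  have b := (basic hq.1 hq.2).rel.2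
  have : (Qf q - (1 + Pf q)) * K (Pf q, Qf q) = 0 := by
    simp only [hK]; linear_combination b
  exact sub_eq_zero.mp ((mul_eq_zero.mp this).resolve_right hk)

lemma sq_root {a b : ℂ} (h : a ^ 2 = b ^ 2) (hn : a + b ≠ 0) : a = b := by
  have : (a - b) * (a + b) = 0 := by linear_combination h
  exact sub_eq_zero.mp ((mul_eq_zero.mp this).resolve_right hn)

lemma phi_tendsto_pow {k : ℕ} (hk : k ≠ 0) : Tendsto (fun q => phi (q ^ k)) (𝓝[≠] 0) (𝓝 1) :=
  phi_tendsto.comp (pow_tendsto hk)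

lemma phi_tendsto_neg {k : ℕ} (hk : k ≠ 0) : Tendsto (fun q => phi (-q ^ k)) (𝓝[≠] 0) (𝓝 1) :=
  phi_tendsto.comp (neg_tendsto.comp (pow_tendsto hk))

lemma ev_m : ∀ᶠ q : ℂ in 𝓝[≠] 0, phi q ^ 2 = (1 + 2 * Pf q) * phi (q ^ 3) ^ 2 := by
  have t : Tendsto (fun q => phi q ^ 2 + (1 + 2 * Pf q) * phi (q ^ 3) ^ 2) (𝓝[≠] 0) (𝓝 (1 ^ 2 + (1 + 2 * 0) * 1 ^ 2)) :=
    (phi_tendsto.pow 2).add (((Pf_tendsto.const_mul 2).const_add 1).mul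
      ((phi_tendsto_pow three_ne_zero).pow 2))
  filter_upwards [ev_small, ev_QP, t.eventually_ne (b₂ := 0) (by norm_num)] with q hq h1 h2
  have b := (basic hq.1 hq.2).f1
  rw [h1] at b
  apply sq_root _ h2
  linear_combination b

lemma ev_D : ∀ᶠ q : ℂ in 𝓝[≠] 0, phi (-q ^ 3) ^ 2 * phi q =
    phi (-q ^ 2) * phi (-q ^ 6) * Qf q * phi (q ^ 3) := by
  have t : Tendsto (fun q => phi (-q ^ 3) ^ 2 * phi q + phi (-q ^ 2) * phi (-q ^ 6) * Qf q * phi (q ^ 3))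
      (𝓝[≠] 0) (𝓝 (1 ^ 2 * 1 + 1 * 1 * 1 * 1)) :=
    (((phi_tendsto_neg three_ne_zero).pow 2).mul phi_tendsto).add
      ((((phi_tendsto_neg two_ne_zero).mul (phi_tendsto_neg (k := 6) (by norm_num))).mul Qf_tendsto).mul
      (phi_tendsto_pow three_ne_zero))
  filter_upwards [ev_small, t.eventually_ne (b₂ := 0) (by norm_num)] with q hq h2
  have b := (basic hq.1 hq.2).f3
  have B0 := (basic hq.1 hq.2).B0
  have v1 := mul_neg_phi hq.1 hq.2
  have v2 := mul_neg_phi (pow_ne_zero 3 hq.1) (norm_pow_lt hq.2 three_ne_zero)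
  simp only [← pow_mul, Nat.reduceMul] at v2
  apply sq_root _ h2
  apply mul_left_cancel₀ B0
  simp only [mul_pow]
  rw [v1, v2]
  linear_combination phi q * b

lemma ev_h : ∀ᶠ q : ℂ in 𝓝[≠] 0,
    phi (q ^ 2) * phi (q ^ 6) + ((1 + Pf q + Pf q ^ 2) * phi (q ^ 3) ^ 2 +
      phi q ^ 2 * phi (-q ^ 3) ^ 2 / (phi (q ^ 3) ^ 2 * Qf q)) * phi (q ^ 3) / (2 * phi q) ≠ 0 := by
  have t : Tendsto (fun q => phi (q ^ 2) * phi (q ^ 6) + ((1 + Pf q + Pf q ^ 2) * phi (q ^ 3) ^ 2 +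
      phi q ^ 2 * phi (-q ^ 3) ^ 2 / (phi (q ^ 3) ^ 2 * Qf q)) * phi (q ^ 3) / (2 * phi q)) (𝓝[≠] 0)
      (𝓝 (1 * 1 + ((1 + 0 + 0 ^ 2) * 1 ^ 2 + 1 ^ 2 * 1 ^ 2 / (1 ^ 2 * 1)) * 1 / (2 * 1))) := by
    refine ((phi_tendsto_pow two_ne_zero).mul (phi_tendsto_pow (k := 6) (by norm_num))).add
      (Tendsto.div (Tendsto.mul (Tendsto.add (((Pf_tendsto.const_add 1).add (Pf_tendsto.pow 2)).mul
        ((phi_tendsto_pow three_ne_zero).pow 2)) (Tendsto.div ((phi_tendsto.pow 2).mul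
        ((phi_tendsto_neg three_ne_zero).pow 2)) (((phi_tendsto_pow three_ne_zero).pow 2).mul Qf_tendsto) (by norm_num)))
        (phi_tendsto_pow three_ne_zero)) (phi_tendsto.const_mul 2) (by norm_num))
  exact t.eventually_ne (by norm_num)

/-- The common parametrisation of the level-24 theta functions. -/
structure Param (P Q A B C D g h r e : ℂ) : Prop where
  r0 : r ≠ 0
  R : r ^ 2 * (1 + r ^ 2) * e ^ 4 = 3 - r ^ 2
  Pr : P = (r ^ 2 - 1) / 2
  Qr : Q = (r ^ 2 + 1) / 2
  hA : A = r * B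
  hC : C = (r ^ 2 + 1) / 2 * r * e ^ 3 * B
  hD : D = (r ^ 2 + 1) / 2 * e * B
  hg : g = (r ^ 2 + 1) / 2 * r * e ^ 2 * B ^ 2
  hh : h = ((r ^ 4 + 3) / 4 + (r ^ 2 + 1) / 2 * r ^ 2 * e ^ 2) * B ^ 2 / (2 * r)

lemma param : ∀ᶠ q : ℂ in 𝓝[≠] 0, ∃ r e : ℂ, Param (Pf q) (Qf q) (phi q) (phi (q ^ 3)) (phi (-q)) (phi (-q ^ 3))
    (phi (-q ^ 2) * phi (-q ^ 6)) (phi (q ^ 2) * phi (q ^ 6)) r e := by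
  filter_upwards [ev_small, ev_QP, ev_m, ev_D, ev_h] with q hq hQ hm hD hh
  obtain ⟨A0, B0, C0, D0, Q0, f1, f2, f3, f4, f5⟩ := basic hq.1 hq.2
  have rl := (basic hq.1 hq.2).rel.1
  have d2 := D2 hq.1 hq.2
  have d23 := D2 (pow_ne_zero 3 hq.1) (norm_pow_lt hq.2 three_ne_zero)
  simp only [← pow_mul, Nat.reduceMul] at d23
  generalize phi q = A at *
  generalize phi (q ^ 3) = B at *
  generalize phi (-q) = C at *
  generalize phi (-q ^ 3) = D at *
  have g0 : phi (-q ^ 2) * phi (-q ^ 6) = D ^ 2 * A / (Qf q * B) := by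
    rw [eq_div_iff (mul_ne_zero Q0 B0)]; linear_combination -hD
  have hC' : C = D ^ 3 * A / (B ^ 3 * Qf q ^ 2) := by
    rw [eq_div_iff (by positivity)]
    apply mul_left_cancel₀ (mul_ne_zero D0 B0)
    linear_combination -f3
  have r2 : (A / B) ^ 2 = 1 + 2 * Pf q := by
    rw [div_pow, div_eq_iff (by positivity)]; exact hm
  have Pr : Pf q = ((A / B) ^ 2 - 1) / 2 := by rw [r2]; ring
  have Qr : Qf q = ((A / B) ^ 2 + 1) / 2 := by rw [hQ, r2]; ring
  have R : (A / B) ^ 2 * (1 + (A / B) ^ 2) * (D / (B * Qf q)) ^ 4 = 3 - (A / B) ^ 2 := by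
    have m0 : 1 + 2 * Pf q ≠ 0 := by
      intro h; rw [h] at r2
      exact pow_ne_zero 2 (div_ne_zero A0 B0) r2
    have k1 : A * (C * D) = (1 - Pf q) * Qf q * B ^ 3 := by
      apply mul_left_cancel₀ m0
      rw [hQ] at rl ⊢
      linear_combination A * rl + B * (1 - Pf q ^ 2) * hm
    have k2 : A ^ 2 * D ^ 4 = (1 - Pf q) * Qf q ^ 3 * B ^ 6 := by
      apply mul_left_cancel₀ B0
      linear_combination A * f3 + B ^ 4 * Qf q ^ 2 * k1
    have : (A / B) ^ 2 * (D / (B * Qf q)) ^ 4 = (1 - Pf q) / Qf q := by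
      field_simp
      linear_combination k2
    have e1 : 1 + (A / B) ^ 2 = 2 * Qf q := by rw [Qr]; ring
    rw [mul_right_comm, this, e1, r2]
    field_simp
    ring
  have hAr : A = A / B * B := by field_simp
  have hDr : D = ((A / B) ^ 2 + 1) / 2 * (D / (B * Qf q)) * B := by rw [← Qr]; field_simp
  have hCr : C = ((A / B) ^ 2 + 1) / 2 * (A / B) * (D / (B * Qf q)) ^ 3 * B := by
    rw [← Qr, hC']; field_simp
  refine ⟨A / B, D / (B * Qf q), div_ne_zero A0 B0, R, Pr, Qr, hAr, hCr, hDr, ?_, ?_⟩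
  · rw [g0, ← Qr]; field_simp
  · have r0 := div_ne_zero A0 B0
    have e1 : ((1 + Pf q + Pf q ^ 2) * B ^ 2 + A ^ 2 * D ^ 2 / (B ^ 2 * Qf q)) * B / (2 * A)
      = (((A / B) ^ 4 + 3) / 4 + ((A / B) ^ 2 + 1) / 2 * (A / B) ^ 2 * (D / (B * Qf q)) ^ 2) * B ^ 2 / (2 * (A / B)) := by
      rw [← Qr]
      have : (A / B) ^ 4 = (1 + 2 * Pf q) ^ 2 := by rw [← r2]; ring
      rw [this]
      field_simp
      ring
    rw [e1] at hh
    refine sq_root ?_ hh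
    have h2 : (phi (q ^ 2) * phi (q ^ 6)) ^ 2 = (A ^ 2 + C ^ 2) * (B ^ 2 + D ^ 2) / 4 := by
      rw [d2, d23]; ring
    rw [h2]
    clear h2 g0 hC' e1 f1 f2 f3 f4 f5 rl d2 d23 hD hm hh
    generalize A / B = r at *
    generalize D / (B * Qf q) = e at *
    rw [hCr, hDr, hAr]
    rw [div_pow, eq_div_iff (pow_ne_zero 2 (mul_ne_zero two_ne_zero r0))]
    linear_combination (B ^ 4 / 2) * (((r ^ 2 + 1) / 2) ^ 2 * (r ^ 2 * ((r ^ 2 + 1) / 2) * e ^ 4 + (3 - r ^ 2) / 2) + r ^ 2 * ((r ^ 2 + 1) / 2) * e ^ 2 - r ^ 2 * ((r ^ 2 + 1) / 2)) * R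

end RF

namespace RF
open Filter Topology

/-- Eisenstein polynomial `1 + 240 ∑ σ₃(n) q^(2n)` in terms of theta constants. -/
noncomputable def eis2 (a b : ℂ) : ℂ := a ^ 8 - a ^ 4 * b ^ 4 + b ^ 8
noncomputable def eis1 (a b : ℂ) : ℂ := 16 * a ^ 8 - 16 * a ^ 4 * b ^ 4 + b ^ 8
noncomputable def eis4 (a b : ℂ) : ℂ := a ^ 8 - a ^ 4 * b ^ 4 + b ^ 8 / 16

set_option maxHeartbeats 4000000 in
lemma big {A B C D g h r e : ℂ}
    (R : r ^ 2 * (1 + r ^ 2) * e ^ 4 = 3 - r ^ 2)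
    (hA : A = r * B)
    (hC : C = (r ^ 2 + 1) / 2 * r * e ^ 3 * B)
    (hD : D = (r ^ 2 + 1) / 2 * e * B)
    (hg : g = (r ^ 2 + 1) / 2 * r * e ^ 2 * B ^ 2)
    (hh : h = (r ^ 2 + 1) / 2 * r * (1 + e ^ 2) ^ 2 / 4 * B ^ 2)
    {x y X Y S T : ℂ} (hx : x = (A + C) / 2) (hy : y = (A - C) / 2)
    (hX : X = (B + D) / 2) (hY : Y = (B - D) / 2)
    (hS : S = x * X + y * Y) (hT : T = y * X - x * Y) :
    A * B * x ^ 2 * h * ((B ^ 2 + D ^ 2) / 2) =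
      (eis1 A C / 8 - eis2 A C / 8 - 9 / 8 * eis1 B D + 9 / 8 * eis2 B D + 2 * eis2 x y
        - 32 * eis4 x y - 18 * eis2 X Y + 288 * eis4 X Y) / 240
      - 4 * (x * X * (g * h) * (y * Y) / 4)
      - 32 * (y ^ 2 * Y ^ 2 * (x * X) * (x * X - y * Y) / 16)
      - 1 / 8 * (A ^ 2 * C ^ 2 * (A ^ 4 - C ^ 4) / 16)
      - 5 / 2 * ((A ^ 2 + C ^ 2) / 2 * (A * C) * (((A ^ 2 + C ^ 2) / 2) ^ 2 - (A * C) ^ 2) / 16)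
      + 9 / 8 * (B ^ 2 * D ^ 2 * (B ^ 4 - D ^ 4) / 16)
      - 27 / 2 * ((B ^ 2 + D ^ 2) / 2 * (B * D) * (((B ^ 2 + D ^ 2) / 2) ^ 2 - (B * D) ^ 2) / 16)
      + 3 / 8 * (A * B * (C * D) * (A * B - C * D) * (2 * h - g) / 4)
      + 2 * (h * g * (h - g) * (x * X + y * Y) / 4)
      + 6 * (x * X * (x * X - y * Y) * (y * Y) * (h + g) / 8)
      - 1 / 4 * ((A ^ 4 - C ^ 4) * ((A ^ 2 + C ^ 2) / 2) * (A * C) / 16)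
      - 9 / 4 * ((B ^ 4 - D ^ 4) * ((B ^ 2 + D ^ 2) / 2) * (B * D) / 16)
      + 5 / 8 * (g * (A * B - C * D) * ((A * B) ^ 2 + (C * D) ^ 2) / 8)
      + 3 / 2 * ((x * X - y * Y) * (h - g) * (h ^ 2 + g ^ 2) / 8)
      + (S ^ 2 + T ^ 2) * S * T / 2
      + 1 / 2 * ((S ^ 2 + T ^ 2) * T * (2 * g - h) / 2)
      - 1 / 4 * ((S ^ 2 - T ^ 2) * h * T / 2) := by
  subst hS hT hx hy hX hY hg hh hC hD hA
  unfold eis1 eis2 eis4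
  linear_combination B ^ 8 * ((-3/128) * r ^ 0 * e ^ 0 + (-3/128) * r ^ 0 * e ^ 1 + (9/512) * r ^ 0 * e ^ 2 + (3/256) * r ^ 0 * e ^ 3 + (15/2048) * r ^ 0 * e ^ 4 + (9/2048) * r ^ 0 * e ^ 5 + (3/8192) * r ^ 0 * e ^ 6 + (-1/128) * r ^ 2 * e ^ 0 + (-1/32) * r ^ 2 * e ^ 1 + (21/512) * r ^ 2 * e ^ 2 + (5/128) * r ^ 2 * e ^ 3 + (49/2048) * r ^ 2 * e ^ 4 + (1/64) * r ^ 2 * e ^ 5 + (67/8192) * r ^ 2 * e ^ 6 + (1/256) * r ^ 2 * e ^ 7 + (5/2048) * r ^ 2 * e ^ 8 + (3/2048) * r ^ 2 * e ^ 9 + (1/8192) * r ^ 2 * e ^ 10 + (-1/128) * r ^ 4 * e ^ 0 + (-271/32768) * r ^ 4 * e ^ 1 + (17/512) * r ^ 4 * e ^ 2 + (1463/32768) * r ^ 4 * e ^ 3 + (73/2048) * r ^ 4 * e ^ 4 + (621/32768) * r ^ 4 * e ^ 5 + (85/4096) * r ^ 4 * e ^ 6 + (299/32768) * r ^ 4 *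 e ^ 7 + (5/512) * r ^ 4 * e ^ 8 + (85/16384) * r ^ 4 * e ^ 9 + (17/8192) * r ^ 4 * e ^ 10 + (9/16384) * r ^ 4 * e ^ 11 + (3/8192) * r ^ 4 * e ^ 13 + (-1/128) * r ^ 6 * e ^ 0 + (-33/32768) * r ^ 6 * e ^ 1 + (3/256) * r ^ 6 * e ^ 2 + (953/32768) * r ^ 6 * e ^ 3 + (59/2048) * r ^ 6 * e ^ 4 + (191/16384) * r ^ 6 * e ^ 5 + (75/4096) * r ^ 6 * e ^ 6 + (41/16384) * r ^ 6 * e ^ 7 + (35/2048) * r ^ 6 * e ^ 8 + (195/32768) * r ^ 6 * e ^ 9 + (31/4096) * r ^ 6 * e ^ 10 + (81/32768) * r ^ 6 * e ^ 11 + (7/4096) * r ^ 6 * e ^ 13 + (1/8192) * r ^ 6 * e ^ 14 + (1/8192) * r ^ 6 * e ^ 17 + (-21/32768) * r ^ 8 * e ^ 1 + (1/512) * r ^ 8 * e ^ 2 + (397/32768) * r ^ 8 * e ^ 3 + (5/512) * r ^ 8 * e ^ 4 + (29/4096) * r ^ 8 * e ^ 5 + (39/8192) * r ^ 8 * e ^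 6 + (-35/4096) * r ^ 8 * e ^ 7 + (35/2048) * r ^ 8 * e ^ 8 + (45/32768) * r ^ 8 * e ^ 9 + (49/4096) * r ^ 8 * e ^ 10 + (147/32768) * r ^ 8 * e ^ 11 + (25/8192) * r ^ 8 * e ^ 13 + (5/8192) * r ^ 8 * e ^ 14 + (3/4096) * r ^ 8 * e ^ 17 + (-3/32768) * r ^ 10 * e ^ 1 + (11/32768) * r ^ 10 * e ^ 3 + (53/16384) * r ^ 10 * e ^ 5 + (-9/8192) * r ^ 10 * e ^ 6 + (-125/16384) * r ^ 10 * e ^ 7 + (5/512) * r ^ 10 * e ^ 8 + (-55/32768) * r ^ 10 * e ^ 9 + (77/8192) * r ^ 10 * e ^ 10 + (135/32768) * r ^ 10 * e ^ 11 + (5/2048) * r ^ 10 * e ^ 13 + (5/4096) * r ^ 10 * e ^ 14 + (15/8192) * r ^ 10 * e ^ 17 + (3/32768) * r ^ 12 * e ^ 5 + (-1/2048) * r ^ 12 * e ^ 6 + (-59/32768) * r ^ 12 * e ^ 7 + (5/2048) * r ^ 12 * e ^ 8 + (-27/32768) * r ^ 12 * e ^ 9 + (29/8192) * r ^ 12 *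 e ^ 10 + (63/32768) * r ^ 12 * e ^ 11 + (5/8192) * r ^ 12 * e ^ 13 + (5/4096) * r ^ 12 * e ^ 14 + (5/2048) * r ^ 12 * e ^ 17 + (1/2048) * r ^ 14 * e ^ 10 + (3/8192) * r ^ 14 * e ^ 11 + (-1/4096) * r ^ 14 * e ^ 13 + (5/8192) * r ^ 14 * e ^ 14 + (15/8192) * r ^ 14 * e ^ 17 + (-1/8192) * r ^ 16 * e ^ 13 + (1/8192) * r ^ 16 * e ^ 14 + (3/4096) * r ^ 16 * e ^ 17 + (1/8192) * r ^ 18 * e ^ 17) * R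

end RF

namespace RF
open Filter Topology

noncomputable def F6 (q : ℂ) : ℂ := q * (E q ^ 2 * E (q ^ 2) ^ 2 * E (q ^ 3) ^ 2 * E (q ^ 6) ^ 2)
noncomputable def F8 (q : ℂ) : ℂ := q * (E (q ^ 2) ^ 4 * E (q ^ 4) ^ 4)
noncomputable def F12 (q : ℂ) : ℂ :=
  q * (E (q ^ 2) ^ 2 * E (q ^ 3) ^ 3 * E (q ^ 4) ^ 3 * E (q ^ 6) ^ 2 / (E q * E (q ^ 12)))
  - q ^ 2 * (E q ^ 3 * E (q ^ 2) ^ 2 * E (q ^ 6) ^ 2 * E (q ^ 12) ^ 3 / (E (q ^ 3) * E (q ^ 4)))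
noncomputable def F16 (q : ℂ) : ℂ := q * (E (q ^ 4) ^ 16 / (E (q ^ 2) ^ 4 * E (q ^ 8) ^ 4))
noncomputable def F24 (q : ℂ) : ℂ :=
  q * (E (q ^ 2) ^ 11 * E (q ^ 6) ^ 11 / (E q ^ 4 * E (q ^ 3) ^ 4 * E (q ^ 4) ^ 3 * E (q ^ 12) ^ 3))

section
variable {q : ℂ} (hq0 : q ≠ 0) (hq : ‖q‖ < 1)

lemma F6_eq (hq0 : q ≠ 0) (hq : ‖q‖ < 1) : F6 q = phi q * phi (q ^ 3) * (phi (-q) * phi (-q ^ 3)) ^ 2 *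
    (phi q * phi (q ^ 3) - phi (-q) * phi (-q ^ 3)) / 4 := by
  have hq3 := norm_pow_lt hq three_ne_zero
  have hq03 := pow_ne_zero 3 hq0
  have n1 := E_ne hq
  have nn : ∀ k, k ≠ 0 → E (q ^ k) ≠ 0 := fun k hk => E_ne (norm_pow_lt hq hk)
  have n2 := nn 2 (by norm_num)
  have n4 := nn 4 (by norm_num)
  have n3 := nn 3 (by norm_num)
  have n6 := nn 6 (by norm_num)
  have n12 := nn 12 (by norm_num)
  rw [D3 hq0 hq, phi_eq hq0 hq, phi_eq hq03 hq3, phi_neg_eq hq0 hq, phi_neg_eq hq03 hq3,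
    psi_eq (pow_ne_zero 2 hq0) (norm_pow_lt hq two_ne_zero),
    psi_eq (pow_ne_zero 6 hq0) (norm_pow_lt hq (k := 6) (by norm_num)), F6]
  simp only [← pow_mul, Nat.reduceMul]
  field_simp

lemma F6_alt (hq0 : q ≠ 0) (hq : ‖q‖ < 1) : F6 (q ^ 2) = q ^ 2 * psi (q ^ 2) ^ 2 * psi (q ^ 6) ^ 2 *
    (phi q * phi (q ^ 3)) * (phi (-q) * phi (-q ^ 3)) := by
  have hq3 := norm_pow_lt hq three_ne_zero
  have hq03 := pow_ne_zero 3 hq0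
  have n1 := E_ne hq
  have nn : ∀ k, k ≠ 0 → E (q ^ k) ≠ 0 := fun k hk => E_ne (norm_pow_lt hq hk)
  have n2 := nn 2 (by norm_num)
  have n4 := nn 4 (by norm_num)
  have n3 := nn 3 (by norm_num)
  have n6 := nn 6 (by norm_num)
  have n12 := nn 12 (by norm_num)
  rw [phi_eq hq0 hq, phi_eq hq03 hq3, phi_neg_eq hq0 hq, phi_neg_eq hq03 hq3,
    psi_eq (pow_ne_zero 2 hq0) (norm_pow_lt hq two_ne_zero),
    psi_eq (pow_ne_zero 6 hq0) (norm_pow_lt hq (k := 6) (by norm_num)), F6]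
  simp only [← pow_mul, Nat.reduceMul]
  field_simp

lemma F8_eq (hq0 : q ≠ 0) (hq : ‖q‖ < 1) : F8 q = phi q ^ 2 * phi (-q) ^ 2 * (phi q ^ 4 - phi (-q) ^ 4) / 16 := by
  have n1 := E_ne hq
  have nn : ∀ k, k ≠ 0 → E (q ^ k) ≠ 0 := fun k hk => E_ne (norm_pow_lt hq hk)
  have n2 := nn 2 (by norm_num)
  have n4 := nn 4 (by norm_num)
  rw [quartic hq0 hq, phi_eq hq0 hq, phi_neg_eq hq0 hq,
    psi_eq (pow_ne_zero 2 hq0) (norm_pow_lt hq two_ne_zero), F8]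
  simp only [← pow_mul, Nat.reduceMul]
  field_simp

lemma F16_eq (hq0 : q ≠ 0) (hq : ‖q‖ < 1) :
    F16 q = (phi q ^ 4 - phi (-q) ^ 4) * phi (q ^ 2) ^ 2 * phi (-q ^ 2) ^ 2 / 16 := by
  have hq2 := norm_pow_lt hq two_ne_zero
  have hq02 := pow_ne_zero 2 hq0
  have n1 := E_ne hq
  have nn : ∀ k, k ≠ 0 → E (q ^ k) ≠ 0 := fun k hk => E_ne (norm_pow_lt hq hk)
  have n2 := nn 2 (by norm_num)
  have n4 := nn 4 (by norm_num)
  have n8 := nn 8 (by norm_num)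
  rw [quartic hq0 hq, phi_eq hq02 hq2, phi_neg_eq hq02 hq2,
    psi_eq (pow_ne_zero 2 hq0) (norm_pow_lt hq two_ne_zero), F16]
  simp only [← pow_mul, Nat.reduceMul]
  field_simp

lemma F24_eq (hq0 : q ≠ 0) (hq : ‖q‖ < 1) :
    F24 q = (phi q * phi (q ^ 3)) ^ 2 * (phi (-q ^ 2) * phi (-q ^ 6)) *
    (phi q * phi (q ^ 3) - phi (-q) * phi (-q ^ 3)) / 4 := by
  have hq3 := norm_pow_lt hq three_ne_zero
  have hq03 := pow_ne_zero 3 hq0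
  have n1 := E_ne hq
  have nn : ∀ k, k ≠ 0 → E (q ^ k) ≠ 0 := fun k hk => E_ne (norm_pow_lt hq hk)
  have n2 := nn 2 (by norm_num)
  have n4 := nn 4 (by norm_num)
  have n3 := nn 3 (by norm_num)
  have n6 := nn 6 (by norm_num)
  have n12 := nn 12 (by norm_num)
  rw [D3 hq0 hq, phi_eq hq0 hq, phi_eq hq03 hq3,
    phi_neg_eq (pow_ne_zero 2 hq0) (norm_pow_lt hq two_ne_zero),
    phi_neg_eq (pow_ne_zero 6 hq0) (norm_pow_lt hq (k := 6) (by norm_num)),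
    psi_eq (pow_ne_zero 2 hq0) (norm_pow_lt hq two_ne_zero),
    psi_eq (pow_ne_zero 6 hq0) (norm_pow_lt hq (k := 6) (by norm_num)), F24]
  simp only [← pow_mul, Nat.reduceMul]
  field_simp

end

lemma Param.h_alt {P Q A B C D g h r e : ℂ} (p : Param P Q A B C D g h r e) :
    h = (r ^ 2 + 1) / 2 * r * (1 + e ^ 2) ^ 2 / 4 * B ^ 2 := by
  have r0 := p.r0
  rw [p.hh, div_eq_iff (mul_ne_zero two_ne_zero r0)]
  linear_combination (-B ^ 2 / 4) * p.R

lemma F12_ev : ∀ᶠ q : ℂ in 𝓝[≠] 0, F12 q =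
    phi q * phi (q ^ 3) * (phi (-q) * phi (-q ^ 3)) * (phi q * phi (q ^ 3) - phi (-q) * phi (-q ^ 3)) *
      (2 * (phi (q ^ 2) * phi (q ^ 6)) - phi (-q ^ 2) * phi (-q ^ 6)) / 4 := by
  filter_upwards [ev_small, param] with q hq0 hp
  obtain ⟨hq0, hq⟩ := hq0
  obtain ⟨r, e, p⟩ := hp
  obtain ⟨r0, R, Pr, Qr, hA, hC, hD, hg, hh⟩ := p
  have b := basic hq0 hq
  have rl := b.rel.1
  have hq3 := norm_pow_lt hq three_ne_zero
  have hq03 := pow_ne_zero 3 hq0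
  have n1 := E_ne hq
  have nn : ∀ k, k ≠ 0 → E (q ^ k) ≠ 0 := fun k hk => E_ne (norm_pow_lt hq hk)
  have n2 := nn 2 (by norm_num)
  have n4 := nn 4 (by norm_num)
  have n3 := nn 3 (by norm_num)
  have n6 := nn 6 (by norm_num)
  have n12 := nn 12 (by norm_num)
  have A0 := b.A0
  have B0 := b.B0
  have Q0 := b.Q0
  have P0 : Pf q ≠ 0 := by
    simp [Pf, hq0, n1, n2, n3, n4, n6, n12]
  have hm : phi q ^ 2 / phi (q ^ 3) ^ 2 = 1 + 2 * Pf q := by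
    rw [Pr, hA]; field_simp; ring
  have m0 : 1 + 2 * Pf q ≠ 0 := by rw [← hm]; positivity
  have hQ : Qf q = 1 + Pf q := by rw [Pr, Qr]; ring
  have k1 : 1 - Pf q = phi (-q) * phi (-q ^ 3) * (1 + 2 * Pf q) / (phi q * phi (q ^ 3) * Qf q) := by
    rw [eq_div_iff (by positivity)]
    rw [hQ] at rl ⊢
    linear_combination -rl
  have d3 := D3 hq0 hq
  have k2 : 2 + Pf q = 4 * q * psi (q ^ 2) * psi (q ^ 6) * (1 + 2 * Pf q) / (phi q * phi (q ^ 3) * Pf q) := by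
    rw [eq_div_iff (by positivity), ← d3]
    rw [hQ] at rl
    linear_combination rl
  -- the right-hand side
  have rhs : phi q * phi (q ^ 3) * (phi (-q) * phi (-q ^ 3)) * (phi q * phi (q ^ 3) - phi (-q) * phi (-q ^ 3)) *
      (2 * (phi (q ^ 2) * phi (q ^ 6)) - phi (-q ^ 2) * phi (-q ^ 6)) / 4 =
      (1 / 8) * Pf q * (1 - Pf q) * Qf q ^ 2 * (1 + 2 * Pf q) * (2 + Pf q) ^ 2 * (phi (q ^ 3) ^ 2 / r) ^ 4
      - (1 / 8) * Pf q ^ 2 * (1 - Pf q) ^ 2 * Qf q * (1 + 2 * Pf q) * (2 + Pf q) * (phi (q ^ 3) ^ 2 / r) ^ 4 := by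
    have cd : phi (-q) * phi (-q ^ 3) = (1 - Pf q ^ 2) * (phi (q ^ 3) ^ 2 / r) := by
      rw [hC, hD, Pr]
      field_simp
      linear_combination (r ^ 2 + 1) * R
    have ab : phi q * phi (q ^ 3) = (1 + 2 * Pf q) * (phi (q ^ 3) ^ 2 / r) := by
      rw [hA, Pr]; field_simp; ring
    have hg' : 2 * (phi (q ^ 2) * phi (q ^ 6)) - phi (-q ^ 2) * phi (-q ^ 6) = (1 + Pf q + Pf q ^ 2) * (phi (q ^ 3) ^ 2 / r) := by
      rw [hh, hg, Pr]; field_simp; ring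
    rw [cd, ab, hg', hQ]; ring
  rw [rhs]
  have hr : r = phi q / phi (q ^ 3) := by rw [hA]; field_simp
  rw [k1, k2, ← hm, hr]
  have hA' := phi_eq hq0 hq
  have hB' := phi_eq hq03 hq3
  have hC' := phi_neg_eq hq0 hq
  have hD' := phi_neg_eq hq03 hq3
  have p2 := psi_eq (pow_ne_zero 2 hq0) (norm_pow_lt hq two_ne_zero)
  have p6 := psi_eq (pow_ne_zero 6 hq0) (norm_pow_lt hq (k := 6) (by norm_num))
  simp only [← pow_mul, Nat.reduceMul] at hB' hD' p2 p6
  rw [hA', hB', hC', hD', p2, p6, F12]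
  congr 1
  · unfold Pf Qf; field_simp; try ring
  · unfold Pf Qf; field_simp; try ring

end RF

namespace RF
open Filter Topology

def EisProp (Eis : ℂ → ℂ) : Prop := ∀ q : ℂ, q ≠ 0 → ‖q‖ < 1 → Eis (q ^ 2) = eis2 (phi q) (phi (-q))

lemma EisProp.one {Eis : ℂ → ℂ} (hE : EisProp Eis) {q : ℂ} (hq0 : q ≠ 0) (hq : ‖q‖ < 1) :
    Eis q = eis1 (phi q) (phi (-q)) := by
  obtain ⟨p, rfl⟩ := IsAlgClosed.exists_pow_nat_eq q (n := 2) (by norm_num)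
  have hp0 : p ≠ 0 := by rintro rfl; simp at hq0
  have hp : ‖p‖ < 1 := by
    rw [norm_pow] at hq
    by_contra h
    exact absurd hq (not_lt.mpr (one_le_pow₀ (not_lt.mp h)))
  rw [hE p hp0 hp]
  have h1 := D2 hp0 hp
  have h2 := mul_neg_phi hp0 hp
  unfold eis1 eis2
  have h3 : phi (p ^ 2) ^ 2 = (phi p ^ 2 + phi (-p) ^ 2) / 2 := by rw [h1]; ring
  rw [show phi (p ^ 2) ^ 8 = (phi (p ^ 2) ^ 2) ^ 4 by ring, show phi (p ^ 2) ^ 4 = (phi (p ^ 2) ^ 2) ^ 2 by ring,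
    show phi (-p ^ 2) ^ 8 = (phi (-p ^ 2) ^ 2) ^ 4 by ring, show phi (-p ^ 2) ^ 4 = (phi (-p ^ 2) ^ 2) ^ 2 by ring,
    h2, h3]
  ring

section
variable {q : ℂ}

lemma x_eq (hq0 : q ≠ 0) (hq : ‖q‖ < 1) : phi (q ^ 4) = (phi q + phi (-q)) / 2 := by
  linear_combination (-1 / 2 : ℂ) * D1 hq0 hq - (1 / 2 : ℂ) * D1neg hq0 hq

lemma y_eq (hq0 : q ≠ 0) (hq : ‖q‖ < 1) : 2 * q * psi (q ^ 8) = (phi q - phi (-q)) / 2 := by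
  linear_combination (-1 / 2 : ℂ) * D1 hq0 hq + (1 / 2 : ℂ) * D1neg hq0 hq

lemma z_eq (hq0 : q ≠ 0) (hq : ‖q‖ < 1) :
    phi (-q ^ 4) ^ 4 = phi (q ^ 4) ^ 4 - (2 * q * psi (q ^ 8)) ^ 4 := by
  have h2 := mul_neg_phi (pow_ne_zero 2 hq0) (norm_pow_lt hq two_ne_zero)
  have h1 := mul_neg_phi hq0 hq
  have d := D2 hq0 hq
  rw [← pow_mul] at h2
  norm_num at h2
  rw [x_eq hq0 hq, y_eq hq0 hq, show phi (-q ^ 4) ^ 4 = (phi (-q ^ 4) ^ 2) ^ 2 by ring, h2, mul_pow, h1]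
  linear_combination (-1 / 2 : ℂ) * phi q * phi (-q) * d

lemma EisProp.eight {Eis : ℂ → ℂ} (hE : EisProp Eis) (hq0 : q ≠ 0) (hq : ‖q‖ < 1) :
    Eis (q ^ 8) = eis2 (phi (q ^ 4)) (2 * q * psi (q ^ 8)) := by
  have := hE (q ^ 4) (pow_ne_zero 4 hq0) (norm_pow_lt hq four_ne_zero)
  rw [← pow_mul] at this
  norm_num at this
  have z := z_eq hq0 hq
  rw [this]
  unfold eis2
  rw [show phi (-q ^ 4) ^ 8 = (phi (-q ^ 4) ^ 4) ^ 2 by ring, z]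
  ring

lemma EisProp.sixteen {Eis : ℂ → ℂ} (hE : EisProp Eis) (hq0 : q ≠ 0) (hq : ‖q‖ < 1) :
    Eis (q ^ 16) = eis4 (phi (q ^ 4)) (2 * q * psi (q ^ 8)) := by
  have h4 := norm_pow_lt hq four_ne_zero
  have h04 := pow_ne_zero 4 hq0
  have := hE (q ^ 8) (pow_ne_zero 8 hq0) (norm_pow_lt hq (k := 8) (by norm_num))
  have d := D2 h04 h4
  have m := mul_neg_phi h04 h4
  simp only [← pow_mul, Nat.reduceMul] at this d m
  have z := z_eq hq0 hq
  rw [this]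
  unfold eis2 eis4
  have d' : phi (q ^ 8) ^ 2 = (phi (q ^ 4) ^ 2 + phi (-q ^ 4) ^ 2) / 2 := by rw [d]; ring
  rw [show phi (-q ^ 8) ^ 8 = (phi (-q ^ 8) ^ 2) ^ 4 by ring, show phi (-q ^ 8) ^ 4 = (phi (-q ^ 8) ^ 2) ^ 2 by ring,
    show phi (q ^ 8) ^ 8 = (phi (q ^ 8) ^ 2) ^ 4 by ring, show phi (q ^ 8) ^ 4 = (phi (q ^ 8) ^ 2) ^ 2 by ring, m, d']
  generalize phi (q ^ 4) = x at *
  generalize phi (-q ^ 4) = w at *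
  generalize 2 * q * psi (q ^ 8) = y at *
  linear_combination ((2 * x ^ 4 + (w ^ 4 - x ^ 4 - y ^ 4)) / 16 + 3 / 4 * x ^ 4 + x ^ 4 / 8) * z

lemma phiI (hq0 : q ≠ 0) (hq : ‖q‖ < 1) : phi (I * q) = phi (q ^ 4) + I * (2 * q * psi (q ^ 8)) := by
  have i8 : I ^ 8 = 1 := by rw [show (8 : ℕ) = 4 * 2 by norm_num, pow_mul, I_pow_four, one_pow]
  rw [D1 (mul_ne_zero I_ne_zero hq0) (by simpa using hq), mul_pow, mul_pow, I_pow_four, i8, one_mul, one_mul]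
  ring

lemma phiIneg (hq0 : q ≠ 0) (hq : ‖q‖ < 1) : phi (-(I * q)) = phi (q ^ 4) - I * (2 * q * psi (q ^ 8)) := by
  have i8 : I ^ 8 = 1 := by rw [show (8 : ℕ) = 4 * 2 by norm_num, pow_mul, I_pow_four, one_pow]
  rw [D1neg (mul_ne_zero I_ne_zero hq0) (by simpa using hq), mul_pow, mul_pow, I_pow_four, i8, one_mul, one_mul]
  ring

end

lemma I_tendsto : Tendsto (fun q : ℂ => I * q) (𝓝[≠] 0) (𝓝[≠] 0) := by
  refine tendsto_nhdsWithin_iff.mpr ⟨?_, ?_⟩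
  · have h := (continuous_const_mul I : Continuous fun q : ℂ => I * q).tendsto 0
    rw [mul_zero] at h
    exact h.mono_left nhdsWithin_le_nhds
  · filter_upwards [self_mem_nhdsWithin] with q h
    exact mul_ne_zero I_ne_zero h

lemma I_pow_6 : I ^ 6 = -1 := by rw [show (6 : ℕ) = 4 + 2 by norm_num, pow_add, I_pow_four, I_sq, one_mul]

lemma main {Eis : ℂ → ℂ} (hE : EisProp Eis) : ∀ᶠ q : ℂ in 𝓝[≠] 0,
    phi q * phi (q ^ 2) * phi (q ^ 3) * phi (q ^ 4) * phi (q ^ 4) * phi (q ^ 6) * phi (q ^ 6) * phi (q ^ 6) =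
    (Eis q / 8 - Eis (q ^ 2) / 8 - 9 / 8 * Eis (q ^ 3) + 9 / 8 * Eis (q ^ 6) + 2 * Eis (q ^ 8)
      - 32 * Eis (q ^ 16) - 18 * Eis (q ^ 24) + 288 * Eis (q ^ 48)) / 240
    - 4 * F6 (q ^ 4) - 32 * F6 (q ^ 8) - 1 / 8 * F8 q - 5 / 2 * F8 (q ^ 2) + 9 / 8 * F8 (q ^ 3)
    - 27 / 2 * F8 (q ^ 6) + 3 / 8 * F12 q + 2 * F12 (q ^ 2) + 6 * F12 (q ^ 4) - 1 / 4 * F16 q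
    - 9 / 4 * F16 (q ^ 3) + 5 / 8 * ((F24 q - F24 (-q)) / 2) + 3 / 2 * ((F24 (q ^ 2) - F24 (-q ^ 2)) / 2)
    + (F6 (I * q) - F6 (-(I * q))) / (2 * I) + 1 / 2 * ((F12 (I * q) - F12 (-(I * q))) / (2 * I))
    - 1 / 4 * ((F24 (I * q) - F24 (-(I * q))) / (2 * I)) := by
  filter_upwards [ev_small, param, F12_ev, (pow_tendsto two_ne_zero).eventually F12_ev,
    (pow_tendsto four_ne_zero).eventually F12_ev, I_tendsto.eventually F12_ev,
    (neg_tendsto.comp I_tendsto).eventually F12_ev] with q hq hp f12 f12_2 f12_4 f12I f12J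
  obtain ⟨hq0, hq⟩ := hq
  obtain ⟨r, e, p⟩ := hp
  have N : ∀ k : ℕ, k ≠ 0 → ‖q ^ k‖ < 1 := fun k hk => norm_pow_lt hq hk
  have Z : ∀ k : ℕ, q ^ k ≠ 0 := fun k => pow_ne_zero k hq0
  have b := big p.R p.hA p.hC p.hD p.hg p.h_alt (x_eq hq0 hq) (y_eq hq0 hq)
    (x_eq (Z 3) (N 3 (by norm_num))) (y_eq (Z 3) (N 3 (by norm_num))) rfl rfl
  clear p
  simp only [← pow_mul, Nat.reduceMul] at b
  -- Eisenstein
  have e1 := hE.one hq0 hq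
  have e3 := hE.one (Z 3) (N 3 (by norm_num))
  have e2 := hE q hq0 hq
  have e6 := hE _ (Z 3) (N 3 (by norm_num))
  have e8 := hE.eight hq0 hq
  have e16 := hE.sixteen hq0 hq
  have e24 := hE.eight (Z 3) (N 3 (by norm_num))
  have e48 := hE.sixteen (Z 3) (N 3 (by norm_num))
  simp only [← pow_mul, Nat.reduceMul] at e3 e6 e24 e48
  -- auxiliary theta relations
  have u2 := D2 hq0 hq
  have v2 := mul_neg_phi hq0 hq
  have U2 := D2 (Z 3) (N 3 (by norm_num))
  have V2 := mul_neg_phi (Z 3) (N 3 (by norm_num))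
  have w2 := mul_neg_phi (Z 2) (N 2 (by norm_num))
  have W2 := mul_neg_phi (Z 6) (N 6 (by norm_num))
  have d34 := D3 (Z 4) (N 4 (by norm_num))
  have d38 := D3 (Z 8) (N 8 (by norm_num))
  have x2 := x_eq (Z 2) (N 2 (by norm_num))
  have y2 := y_eq (Z 2) (N 2 (by norm_num))
  have x6 := x_eq (Z 6) (N 6 (by norm_num))
  have y6 := y_eq (Z 6) (N 6 (by norm_num))
  simp only [← pow_mul, Nat.reduceMul] at U2 V2 w2 W2 d34 d38 x2 y2 x6 y6
  have u2' : phi (q ^ 2) ^ 2 = (phi q ^ 2 + phi (-q) ^ 2) / 2 := by rw [u2]; ring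
  have U2' : phi (q ^ 6) ^ 2 = (phi (q ^ 3) ^ 2 + phi (-q ^ 3) ^ 2) / 2 := by rw [U2]; ring
  have n4 : phi (-q ^ 4) * phi (-q ^ 12) = phi (q ^ 4) * phi (q ^ 12) - 2 * q * psi (q ^ 8) * (2 * q ^ 3 * psi (q ^ 24)) := by
    linear_combination -d34
  have k8 : 2 * (phi (q ^ 8) * phi (q ^ 24)) - phi (-q ^ 8) * phi (-q ^ 24)
      = (phi (q ^ 2) * phi (q ^ 6) + phi (-q ^ 2) * phi (-q ^ 6)) / 2 := by
    have : phi (-q ^ 8) * phi (-q ^ 24) = phi (q ^ 8) * phi (q ^ 24) - 2 * q ^ 2 * psi (q ^ 16) * (2 * q ^ 6 * psi (q ^ 48)) := by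
      linear_combination -d38
    rw [this, y2, y6, x2, x6]; ring
  -- cusp forms
  have a6_4 := F6_eq (Z 4) (N 4 (by norm_num))
  have a6_8 := F6_alt (Z 4) (N 4 (by norm_num))
  have a8 := F8_eq hq0 hq
  have a8_2 := F8_eq (Z 2) (N 2 (by norm_num))
  have a8_3 := F8_eq (Z 3) (N 3 (by norm_num))
  have a8_6 := F8_eq (Z 6) (N 6 (by norm_num))
  have a16 := F16_eq hq0 hq
  have a16_3 := F16_eq (Z 3) (N 3 (by norm_num))
  have a24 := F24_eq hq0 hq
  have a24n := F24_eq (neg_ne_zero.mpr hq0) (by simpa using hq)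
  have a24_2 := F24_eq (Z 2) (N 2 (by norm_num))
  have a24_2n := F24_eq (neg_ne_zero.mpr (Z 2)) (by simpa using N 2 (by norm_num))
  have Iq0 := mul_ne_zero I_ne_zero hq0
  have Iq : ‖I * q‖ < 1 := by simpa using hq
  have a6I := F6_eq Iq0 Iq
  have a6J := F6_eq (neg_ne_zero.mpr Iq0) (by simpa using hq)
  have a24I := F24_eq Iq0 Iq
  have a24J := F24_eq (neg_ne_zero.mpr Iq0) (by simpa using hq)
  have neg3 : ∀ z : ℂ, (-z) ^ 3 = - z ^ 3 := fun z => by ring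
  have neg2 : ∀ z : ℂ, (-z) ^ 2 = z ^ 2 := fun z => by ring
  have neg6 : ∀ z : ℂ, (-z) ^ 6 = z ^ 6 := fun z => by ring
  have I3 : (I * q) ^ 3 = -(I * q ^ 3) := by rw [mul_pow, I_pow_three]; ring
  have I2 : (I * q) ^ 2 = - q ^ 2 := by rw [mul_pow, I_sq]; ring
  have I6 : (I * q) ^ 6 = - q ^ 6 := by rw [mul_pow, I_pow_6]; ring
  have i1 := phiI hq0 hq
  have i3 := phiI (Z 3) (N 3 (by norm_num))
  have j1 := phiIneg hq0 hq
  have j3 := phiIneg (Z 3) (N 3 (by norm_num))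
  simp only [Function.comp] at f12J
  simp only [neg3, neg2, neg6, I3, I2, I6, neg_neg] at f12I f12J a6I a6J a24I a24J a24n a24_2n
  simp only [← pow_mul, Nat.reduceMul] at i3 j3 f12_2 f12_4 a6_4 a6_8 a8_2 a8_3 a8_6 a16_3 a24_2 a24_2n
  rw [i1, i3, j1, j3] at f12I f12J a6I a6J a24I a24J
  have N2 : (phi (-q ^ 4) * phi (-q ^ 12)) ^ 2 = phi (q ^ 2) * phi (-q ^ 2) * (phi (q ^ 6) * phi (-q ^ 6)) := by
    rw [mul_pow, w2, W2]
  rw [n4] at f12_2 a24_2 a24_2n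
  rw [k8] at f12_4
  rw [N2] at a6_4
  rw [n4] at f12_4 a6_4 a6_8
  have hI : (2 * I) ≠ 0 := mul_ne_zero two_ne_zero I_ne_zero
  have c6_8 : F6 (q ^ 8) = (2 * q * psi (q ^ 8)) ^ 2 * (2 * q ^ 3 * psi (q ^ 24)) ^ 2 * (phi (q ^ 4) * phi (q ^ 12)) *
      (phi (q ^ 4) * phi (q ^ 12) - 2 * q * psi (q ^ 8) * (2 * q ^ 3 * psi (q ^ 24))) / 16 := by
    rw [a6_8]; ring
  clear a6_8
  generalize 2 * q * psi (q ^ 8) = y at *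
  generalize 2 * q ^ 3 * psi (q ^ 24) = Y at *
  generalize phi (q ^ 4) = x at *
  generalize phi (q ^ 12) = X at *
  have hs : (x + I * y) * (X - I * Y) = (x * X + y * Y) + I * (y * X - x * Y) := by
    linear_combination (-y * Y) * I_sq
  have ht : (x - I * y) * (X + I * Y) = (x * X + y * Y) - I * (y * X - x * Y) := by
    linear_combination (-y * Y) * I_sq
  rw [hs, ht] at f12I f12J a6I a6J a24I a24J
  rw [show 2 * (x * X) - (x * X - y * Y) = x * X + y * Y by ring] at f12_2
  generalize x * X + y * Y = S at *
  generalize y * X - x * Y = T at *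
  have t6 : (F6 (I * q) - F6 (-(I * q))) / (2 * I) = (S ^ 2 + T ^ 2) * S * T / 2 := by
    rw [div_eq_iff hI, a6I, a6J]
    linear_combination (-T ^ 2 * I * S * T) * I_sq
  have t12 : (F12 (I * q) - F12 (-(I * q))) / (2 * I) = (S ^ 2 + T ^ 2) * T *
      (2 * (phi (-q ^ 2) * phi (-q ^ 6)) - phi (q ^ 2) * phi (q ^ 6)) / 2 := by
    rw [div_eq_iff hI, f12I, f12J]
    linear_combination (-T ^ 2 * I * T * (2 * (phi (-q ^ 2) * phi (-q ^ 6)) - phi (q ^ 2) * phi (q ^ 6))) * I_sq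
  have t24 : (F24 (I * q) - F24 (-(I * q))) / (2 * I) = (S ^ 2 - T ^ 2) * (phi (q ^ 2) * phi (q ^ 6)) * T / 2 := by
    rw [div_eq_iff hI, a24I, a24J]
    linear_combination (T ^ 2 * I * T * (phi (q ^ 2) * phi (q ^ 6))) * I_sq
  have p4 : ∀ z : ℂ, z ^ 4 = (z ^ 2) ^ 2 := fun z => by ring
  have c8_2 : F8 (q ^ 2) = (phi q ^ 2 + phi (-q) ^ 2) / 2 * (phi q * phi (-q)) *
      (((phi q ^ 2 + phi (-q) ^ 2) / 2) ^ 2 - (phi q * phi (-q)) ^ 2) / 16 := by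
    rw [a8_2, p4 (phi (q ^ 2)), p4 (phi (-q ^ 2)), u2', v2]
  have c8_6 : F8 (q ^ 6) = (phi (q ^ 3) ^ 2 + phi (-q ^ 3) ^ 2) / 2 * (phi (q ^ 3) * phi (-q ^ 3)) *
      (((phi (q ^ 3) ^ 2 + phi (-q ^ 3) ^ 2) / 2) ^ 2 - (phi (q ^ 3) * phi (-q ^ 3)) ^ 2) / 16 := by
    rw [a8_6, p4 (phi (q ^ 6)), p4 (phi (-q ^ 6)), U2', V2]
  rw [u2', v2] at a16
  rw [U2', V2] at a16_3
  rw [t6, t12, t24, c8_2, c8_6, c6_8, a6_4, a8, a8_3, f12, f12_2, f12_4, a16, a16_3, a24, a24n, a24_2, a24_2n,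
    e1, e2, e3, e6, e8, e16, e24, e48]
  rw [← U2'] at b ⊢
  linear_combination b

end RF

namespace RF
open Filter Topology
open scoped MatrixGroups UpperHalfPlane ModularForm

lemma theta_eq_phi (τ : ℂ) : jacobiTheta τ = phi (Complex.exp (π * I * τ)) := by
  unfold jacobiTheta phi
  refine tsum_congr fun n => ?_
  rw [← Complex.exp_int_mul]; congr 1; push_cast; ring

lemma exp_add_one (τ : ℂ) : Complex.exp (π * I * (τ + 1)) = - Complex.exp (π * I * τ) := by
  rw [mul_add, mul_one, Complex.exp_add, Complex.exp_pi_mul_I]; ring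

lemma norm_nome {τ : ℂ} (h : 0 < τ.im) : ‖Complex.exp (π * I * τ)‖ < 1 := by
  rw [Complex.norm_exp]
  simp only [mul_re, ofReal_re, I_re, mul_zero, ofReal_im, I_im, mul_one, sub_self, zero_mul, mul_im, zero_add, zero_sub, add_zero]
  rw [Real.exp_lt_one_iff]
  have := mul_pos Real.pi_pos h
  linarith

lemma theta_half (τ : ℂ) : jacobiTheta (τ + 1) = jacobiTheta₂ (1 / 2) τ := by
  unfold jacobiTheta jacobiTheta₂
  refine tsum_congr fun n => ?_
  rw [jacobiTheta₂_term, mul_add, Complex.exp_add, Complex.exp_add, mul_comm]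
  congr 1
  have h1 : (2 * π * I * n * (1 / 2) : ℂ) = n * (π * I) := by ring
  have h2 : (π * I * (n : ℂ) ^ 2 * 1 : ℂ) = ((n ^ 2 : ℤ) : ℂ) * (π * I) := by push_cast; ring
  rw [h1, h2, Complex.exp_int_mul, Complex.exp_int_mul, Complex.exp_pi_mul_I]
  rcases Int.even_or_odd n with h | h
  · rw [h.neg_one_zpow, (h.pow_of_ne_zero two_ne_zero).neg_one_zpow]
  · rw [h.neg_one_zpow, (h.pow).neg_one_zpow]

lemma theta2_tau {τ : ℂ} (h : 0 < τ.im) :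
    jacobiTheta₂ (τ / 2) τ = 2 * psi (Complex.exp (π * I * τ) ^ 2) := by
  have hq := norm_nome h
  have hq0 := Complex.exp_ne_zero (π * I * τ)
  have hp := hasSum_psi (pow_ne_zero 2 hq0) (norm_pow_lt hq two_ne_zero)
  have key : HasSum (fun n : ℤ => Complex.exp (π * I * τ) ^ (n ^ 2 + n)) (2 * psi (Complex.exp (π * I * τ) ^ 2)) := by
    rw [two_mul]
    apply int_even_odd
    · refine HasSum.congr_fun' ((Equiv.neg ℤ).hasSum_iff.mpr hp) (fun n => ?_) rfl
      simp only [Function.comp, Equiv.neg_apply]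
      rw [pz]; congr 1; push_cast; ring
    · refine HasSum.congr_fun' ((Equiv.addRight (1 : ℤ)).hasSum_iff.mpr hp) (fun n => ?_) rfl
      simp only [Function.comp, Equiv.coe_addRight]
      rw [pz]; congr 1; push_cast; ring
  rw [← key.tsum_eq, jacobiTheta₂]
  refine tsum_congr fun n => ?_
  rw [jacobiTheta₂_term, ← Complex.exp_int_mul]; congr 1; push_cast; ring

lemma theta_S_one {τ : ℂ} (h : 0 < τ.im) : jacobiTheta (-1 / τ + 1) ^ 4 =
    - τ ^ 2 * (jacobiTheta τ ^ 4 - jacobiTheta (τ + 1) ^ 4) := by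
  have h0 : τ ≠ 0 := by rintro rfl; simp at h
  rw [theta_half, jacobiTheta₂_functional_equation, theta_eq_phi, theta_eq_phi, exp_add_one,
    quartic (Complex.exp_ne_zero _) (norm_nome h)]
  have e1 : (1 / 2 : ℂ) / (-1 / τ) = -(τ / 2) := by field_simp
  have e2 : (-1 : ℂ) / (-1 / τ) = τ := by field_simp
  rw [e1, e2, jacobiTheta₂_neg_left, theta2_tau h]
  have e3 : (-π * I * (1 / 2) ^ 2 / (-1 / τ) : ℂ) = (π * I * τ) / 4 := by field_simp; norm_num
  have e4 : Complex.exp ((π * I * τ) / 4) ^ 4 = Complex.exp (π * I * τ) := by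
    rw [← Complex.exp_nat_mul]; congr 1; push_cast; ring
  have e5 : ((-I * (-1 / τ)) ^ (1 / 2 : ℂ)) ^ 4 = (-I * (-1 / τ)) ^ 2 := by
    rw [← Complex.cpow_nat_mul]
    norm_num
  rw [e3]
  simp only [mul_pow, div_pow, e4, one_pow]
  rw [e5]
  simp only [mul_pow, div_pow, neg_sq, I_sq]
  field_simp
  ring

lemma theta_S {τ : ℂ} (h : 0 < τ.im) : jacobiTheta (-1 / τ) ^ 4 = - τ ^ 2 * jacobiTheta τ ^ 4 := by
  have := jacobiTheta_S_smul ⟨τ, h⟩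
  rw [UpperHalfPlane.modular_S_smul] at this
  simp only [UpperHalfPlane.coe_mk] at this
  rw [show -1 / τ = (-τ)⁻¹ by field_simp, this, mul_pow, ← Complex.cpow_nat_mul]
  norm_num
  rw [mul_pow, I_sq]; ring

noncomputable def thF (τ : ℂ) : ℂ :=
  jacobiTheta τ ^ 8 - jacobiTheta τ ^ 4 * jacobiTheta (τ + 1) ^ 4 + jacobiTheta (τ + 1) ^ 8

lemma thF_add_one (τ : ℂ) : thF (τ + 1) = thF τ := by
  unfold thF
  rw [show τ + 1 + 1 = 2 + τ by ring, jacobiTheta_two_add]; ring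

lemma thF_S {τ : ℂ} (h : 0 < τ.im) : thF (-1 / τ) = τ ^ 4 * thF τ := by
  unfold thF
  rw [show jacobiTheta (-1 / τ) ^ 8 = (jacobiTheta (-1 / τ) ^ 4) ^ 2 by ring,
    show jacobiTheta (-1 / τ + 1) ^ 8 = (jacobiTheta (-1 / τ + 1) ^ 4) ^ 2 by ring, theta_S h, theta_S_one h]
  ring

lemma theta_tendsto : Tendsto (fun z : ℍ => jacobiTheta z) UpperHalfPlane.atImInfty (𝓝 1) := by
  have h := isBigO_at_im_infty_jacobiTheta_sub_one
  have h2 : Tendsto (fun τ : ℂ => rexp (-π * τ.im)) (comap im atTop) (𝓝 0) := by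
    have : Tendsto (fun t : ℝ => rexp (-π * t)) atTop (𝓝 0) := by
      refine Real.tendsto_exp_atBot.comp ?_
      exact tendsto_id.const_mul_atTop_of_neg (by linarith [Real.pi_pos])
    exact this.comp tendsto_comap
  have h3 := h.trans_tendsto h2
  have h4 : Tendsto (fun z : ℍ => (z : ℂ)) UpperHalfPlane.atImInfty (comap im atTop) := by
    rw [tendsto_comap_iff]
    exact tendsto_comap
  have h5 := (h3.comp h4).add_const 1
  simpa [Function.comp_def] using h5

lemma theta_tendsto_one : Tendsto (fun z : ℍ => jacobiTheta (z + 1)) UpperHalfPlane.atImInfty (𝓝 1) := by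
  have h : Tendsto (fun z : ℍ => (1 : ℝ) +ᵥ z) UpperHalfPlane.atImInfty UpperHalfPlane.atImInfty := by
    unfold UpperHalfPlane.atImInfty
    rw [tendsto_comap_iff]
    refine tendsto_comap.congr fun z => ?_
    simp
  refine (theta_tendsto.comp h).congr fun z => ?_
  simp [add_comm]

lemma thF_tendsto : Tendsto (fun z : ℍ => thF z) UpperHalfPlane.atImInfty (𝓝 1) := by
  have := ((theta_tendsto.pow 8).sub ((theta_tendsto.pow 4).mul (theta_tendsto_one.pow 4))).add (theta_tendsto_one.pow 8)
  simpa [thF] using this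

lemma thF_slash_S : (fun z : ℍ => thF z) ∣[(4 : ℤ)] ModularGroup.S = fun z : ℍ => thF z := by
  ext z
  have h := thF_S z.2
  have h0 := z.ne_zero
  suffices thF (-(↑z)⁻¹) * ((z : ℂ) ^ 4)⁻¹ = thF z by
    rw [ModularForm.SL_slash_apply, UpperHalfPlane.modular_S_smul, ModularGroup.denom_S]
    rw [UpperHalfPlane.coe_mk, zpow_neg]
    rw [show (-(z : ℂ))⁻¹ = -(z : ℂ)⁻¹ from inv_neg]
    exact this
  rw [show -(z : ℂ)⁻¹ = -1 / z by field_simp]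
  have h' : thF (-1 / (z : ℂ)) = (z : ℂ) ^ 4 * thF z := h
  rw [h']
  field_simp

lemma thF_slash_T : (fun z : ℍ => thF z) ∣[(4 : ℤ)] ModularGroup.T = fun z : ℍ => thF z := by
  ext z
  rw [ModularForm.SL_slash_apply, UpperHalfPlane.modular_T_smul, ModularGroup.denom_apply]
  simp only [ModularGroup.T]
  simp [add_comm, ← thF_add_one z]

noncomputable def thMF : ModularForm 𝒮ℒ 4 where
  toFun := fun z : ℍ => thF z
  slash_action_eq' A hA := by
    obtain ⟨A, rfl⟩ := hA
    exact SlashInvariantForm.slash_action_generators_SL2Z thF_slash_S thF_slash_T A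
  holo' := by
    rw [UpperHalfPlane.mdifferentiable_iff]
    have d : DifferentiableOn ℂ thF {z | 0 < z.im} := by
      intro z hz
      have h1 := differentiableAt_jacobiTheta hz
      have h2 : DifferentiableAt ℂ (fun z => jacobiTheta (z + 1)) z :=
        DifferentiableAt.comp (g := jacobiTheta) (f := fun z => z + 1) z (differentiableAt_jacobiTheta (by simpa using hz)) (by fun_prop)
      exact (((h1.pow 8).sub ((h1.pow 4).mul (h2.pow 4))).add (h2.pow 8)).differentiableWithinAt
    refine d.congr fun z hz => ?_
    simp [UpperHalfPlane.ofComplex_apply_of_im_pos hz]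
  bdd_at_cusps' hc := by
    rw [Subgroup.IsArithmetic.isCusp_iff_isCusp_SL2Z] at hc
    rw [OnePoint.isBoundedAt_iff_forall_SL2Z hc]
    intro γ _
    rw [SlashInvariantForm.slash_action_generators_SL2Z thF_slash_S thF_slash_T]
    exact thF_tendsto.isBigO_one ℝ


lemma thMF_eq : (ModularForm.E₄ : ModularForm 𝒮ℒ 4) = thMF := by
  obtain ⟨c, hc⟩ : ∃ c : ℂ, c • ModularForm.E₄ = thMF :=
    (finrank_eq_one_iff_of_nonzero' ModularForm.E₄ (EisensteinSeries.E_ne_zero _ ⟨2, rfl⟩)).mp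
      (Module.rank_eq_one_iff_finrank_eq_one.mp ModularForm.levelOne_weight_four_rank_one) _
  have h1 : (UpperHalfPlane.qExpansion 1 (thMF : ℍ → ℂ)).coeff 0 = 1 := by
    rw [UpperHalfPlane.qExpansion_coeff_zero one_pos (ModularFormClass.analyticAt_cuspFunction_zero thMF one_pos one_mem_strictPeriods_SL) (SlashInvariantFormClass.periodic_comp_ofComplex thMF one_mem_strictPeriods_SL)]
    exact thF_tendsto.limUnder_eq
  have hc1 : c = 1 := by
    rw [← hc, FunLike.coe_smul, ModularForm.qExpansion_smul one_pos one_mem_strictPeriods_SL, PowerSeries.coeff_smul,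
      EisensteinSeries.E_qExpansion_coeff_zero _ ⟨2, rfl⟩] at h1
    simpa using h1
  rw [hc1, one_smul] at hc
  exact hc

noncomputable def Eis (q : ℂ) : ℂ := 1 + 240 * ∑' n : ℕ, ((ArithmeticFunction.sigma 3 (n + 1) : ℕ) : ℂ) * q ^ (n + 1)

lemma eisProp : EisProp Eis := by
  intro q hq0 hq
  obtain ⟨τ, hτ, rfl⟩ := exists_tau hq0 hq
  have h := congrArg (fun f : ModularForm 𝒮ℒ 4 => f ⟨τ, hτ⟩) thMF_eq
  have h2 := EisensteinSeries.q_expansion_bernoulli (k := 4) (by norm_num) ⟨2, rfl⟩ ⟨τ, hτ⟩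
  have h3 : (thMF ⟨τ, hτ⟩ : ℂ) = thF τ := rfl
  have h4 : (ModularForm.E₄ : ModularForm 𝒮ℒ 4) ⟨τ, hτ⟩ = thF τ := h
  have h5 : Complex.exp (π * I * τ) ^ 2 = Complex.exp (2 * π * I * τ) := by
    rw [← Complex.exp_nat_mul]; congr 1; push_cast; ring
  unfold Eis eis2
  rw [← exp_add_one, ← theta_eq_phi, ← theta_eq_phi]
  rw [← thF, ← h4]
  refine Eq.trans ?_ h2.symm
  rw [show bernoulli 4 = -1 / 30 by decide +kernel, h5]
  simp_rw [zpow_natCast]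
  rw [← tsum_pnat_eq_tsum_succ (f := fun n : ℕ => ((ArithmeticFunction.sigma 3 n : ℕ) : ℂ) * Complex.exp (2 * π * I * τ) ^ (n : ℕ))]
  push_cast
  norm_num

end RF

namespace RF
open Filter Topology

/-- `c` is the coefficient sequence of `f` near `0`. -/
def GS (c : ℕ → ℂ) (f : ℂ → ℂ) : Prop := ∀ᶠ q : ℂ in 𝓝[≠] 0, HasSum (fun n => c n * q ^ n) (f q)

lemma GS.add {c d : ℕ → ℂ} {f g : ℂ → ℂ} (h : GS c f) (h' : GS d g) :
    GS (fun n => c n + d n) (fun q => f q + g q) := by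
  filter_upwards [h, h'] with q h1 h2
  simpa only [add_mul] using h1.add h2

lemma GS.sub {c d : ℕ → ℂ} {f g : ℂ → ℂ} (h : GS c f) (h' : GS d g) :
    GS (fun n => c n - d n) (fun q => f q - g q) := by
  filter_upwards [h, h'] with q h1 h2
  simpa only [sub_mul] using h1.sub h2

lemma GS.mul_left {c : ℕ → ℂ} {f : ℂ → ℂ} (h : GS c f) (a : ℂ) :
    GS (fun n => a * c n) (fun q => a * f q) := by
  filter_upwards [h] with q h1
  simpa only [mul_assoc] using h1.mul_left a

lemma GS.div {c : ℕ → ℂ} {f : ℂ → ℂ} (h : GS c f) (a : ℂ) :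
    GS (fun n => c n / a) (fun q => f q / a) := by
  filter_upwards [h] with q h1
  simpa only [div_mul_eq_mul_div] using h1.div_const a

lemma GS.subst {c : ℕ → ℂ} {f : ℂ → ℂ} (h : GS c f) {k : ℕ} (hk : k ≠ 0) :
    GS (fun n => if k ∣ n then c (n / k) else 0) (fun q => f (q ^ k)) := by
  filter_upwards [(pow_tendsto hk).eventually h] with q h1
  have hinj : Function.Injective (fun m : ℕ => k * m) := mul_right_injective₀ hk
  refine (Function.Injective.hasSum_iff hinj ?_).mp ?_
  · intro x hx
    rw [if_neg, zero_mul]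
    rintro ⟨m, rfl⟩
    exact hx ⟨m, rfl⟩
  · convert h1 using 2 with m
    simp [Nat.mul_div_cancel_left _ (Nat.pos_of_ne_zero hk), pow_mul]

lemma GS.twist {c : ℕ → ℂ} {f : ℂ → ℂ} (h : GS c f) {w : ℂ} (hw : w ≠ 0) :
    GS (fun n => c n * w ^ n) (fun q => f (w * q)) := by
  have ht : Tendsto (fun q : ℂ => w * q) (𝓝[≠] 0) (𝓝[≠] 0) := by
    refine tendsto_nhdsWithin_of_tendsto_nhds_of_eventually_within _ ?_ ?_
    · have : Tendsto (fun q : ℂ => w * q) (𝓝 0) (𝓝 (w * 0)) := tendsto_id.const_mul w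
      rw [mul_zero] at this
      exact this.mono_left nhdsWithin_le_nhds
    · filter_upwards [self_mem_nhdsWithin] with q hq
      exact mul_ne_zero hw hq
  filter_upwards [ht.eventually h] with q h1
  simpa only [mul_pow, mul_assoc] using h1

lemma GS.congr {c d : ℕ → ℂ} {f g : ℂ → ℂ} (h : GS c f) (hc : ∀ n, d n = c n) (hf : ∀ q, g q = f q) : GS d g := by
  rw [funext hc, funext hf]; exact h

lemma GS.unique {c d : ℕ → ℂ} {f g : ℂ → ℂ} (h : GS c f) (h' : GS d g) (hfg : ∀ᶠ q in 𝓝[≠] 0, f q = g q) : c = d := by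
  have h0 := h.sub h'
  set e : ℕ → ℂ := fun n => c n - d n with he
  have hz : ∀ᶠ q : ℂ in 𝓝[≠] 0, HasSum (fun n => e n * q ^ n) 0 := by
    filter_upwards [h0, hfg] with q h1 h2
    rwa [h2, sub_self] at h1
  let G : ℂ → ℂ := fun q => ∑' n, e n * q ^ n
  have hp : HasFPowerSeriesAt G (FormalMultilinearSeries.ofScalars ℂ e) 0 := by
    rw [hasFPowerSeriesAt_iff]
    rw [eventually_nhdsWithin_iff] at hz
    filter_upwards [hz] with q hq
    have hs : Summable fun n => e n * q ^ n := by
      by_cases h0 : q = 0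
      · subst h0
        refine summable_of_ne_finset_zero (s := {0}) fun n hn => ?_
        simp at hn
        simp [hn]
      · exact (hq h0).summable
    simp only [FormalMultilinearSeries.coeff_ofScalars, smul_eq_mul, zero_add, mul_comm (q ^ _)]
    exact hs.hasSum
  have hG : ∀ᶠ q in 𝓝 0, G q = 0 := by
    refine hp.analyticAt.frequently_zero_iff_eventually_zero.mp ?_
    refine Eventually.frequently ?_
    filter_upwards [hz] with q hq
    exact hq.tsum_eq
  have h3 := (hp.congr hG).eq_zero
  rw [FormalMultilinearSeries.ofScalars_series_eq_zero] at h3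
  funext n
  exact sub_eq_zero.mp (congrFun h3 n)

/-- Coefficients with the constant term removed. -/
def Z (a : ℕ → ℤ) (n : ℕ) : ℂ := if n = 0 then 0 else (a n : ℂ)

lemma GS_of_tsum {a : ℕ → ℤ} {F : ℂ → ℂ}
    (h : ∀ q : ℂ, q ≠ 0 → ‖q‖ < 1 → F q = ∑' m : ℕ, (a (m + 1) : ℂ) * q ^ (m + 1))
    (hF : ∀ᶠ q in 𝓝[≠] 0, F q ≠ 0) : GS (Z a) F := by
  filter_upwards [ev_small, hF] with q hq h0
  rw [← hasSum_nat_add_iff' 1]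
  have e := h q hq.1 hq.2
  have hs : Summable fun m : ℕ => (a (m + 1) : ℂ) * q ^ (m + 1) := by
    by_contra hn
    rw [tsum_eq_zero_of_not_summable hn] at e
    exact h0 e
  simp only [Z, Nat.add_eq_zero_iff, one_ne_zero, and_false, if_false, range_one, sum_singleton, if_true, zero_mul, sub_zero]
  rw [e]
  exact hs.hasSum

lemma eta_fact (q z : ℂ) (hq : Complex.exp (2 * Real.pi * Complex.I * z) = q) :
    ∃ u : ℂ, u ≠ 0 ∧ u ^ 24 = q ∧ dedekindEta z = u * E q ∧ ∀ d : ℕ, dedekindEta (d * z) = u ^ d * E (q ^ d) := by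
  have key : ∀ d : ℕ, dedekindEta (d * z) = Complex.exp (Real.pi * Complex.I * z / 12) ^ d * E (q ^ d) := by
    intro d
    unfold dedekindEta E
    rw [← Complex.exp_nat_mul]
    congr 1
    · congr 1; ring
    · refine tprod_congr fun m => ?_
      rw [← hq, ← pow_mul, ← Complex.exp_nat_mul]
      congr 2; push_cast; ring
  refine ⟨Complex.exp (Real.pi * Complex.I * z / 12), Complex.exp_ne_zero _, ?_, ?_, key⟩
  · rw [← hq, ← Complex.exp_nat_mul]; congr 1; push_cast; ring
  · simpa using key 1

lemma exists_z {q : ℂ} (hq0 : q ≠ 0) (hq : ‖q‖ < 1) :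
    ∃ z : ℂ, 0 < z.im ∧ Complex.exp (2 * Real.pi * Complex.I * z) = q := by
  obtain ⟨τ, h1, h2⟩ := exists_tau hq0 hq
  refine ⟨τ / 2, by simpa using h1, ?_⟩
  rw [← h2]; congr 1; ring

end RF

namespace RF
open Filter Topology

lemma ev_E (k : ℕ) (hk : k ≠ 0) : ∀ᶠ q : ℂ in 𝓝[≠] 0, E (q ^ k) ≠ 0 := by
  filter_upwards [ev_small] with q hq
  exact E_ne (norm_pow_lt hq.2 hk)

lemma GS_a6 (a6 : ℕ → ℤ) (ha6 : ∀ z : ℂ, 0 < z.im →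
      dedekindEta z ^ (2 : ℤ) * dedekindEta (2 * z) ^ (2 : ℤ) * dedekindEta (3 * z) ^ (2 : ℤ) * dedekindEta (6 * z) ^ (2 : ℤ)
        = ∑' m : ℕ, (a6 (m + 1) : ℂ) * Complex.exp (2 * Real.pi * Complex.I * z) ^ (m + 1)) : GS (Z a6) F6 := by
  refine GS_of_tsum (fun q hq0 hq => ?_) ?_
  · obtain ⟨z, hz, hzq⟩ := exists_z hq0 hq
    have h := ha6 z hz
    obtain ⟨u, hu0, hu, h1, hd⟩ := eta_fact q z hzq
    have h2 := hd 2
    have h3 := hd 3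
    have h6 := hd 6
    push_cast at h2 h3 h6
    rw [hzq] at h
    rw [← h, h1, h2, h3, h6, F6]
    generalize E q = e1 at *
    generalize E (q ^ 2) = e2 at *
    generalize E (q ^ 3) = e3 at *
    generalize E (q ^ 6) = e6 at *
    rw [← hu]
    simp only [zpow_ofNat]
    ring
  · filter_upwards [ev_small] with q hq
    have n1 := E_ne hq.2
    have n2 := E_ne (norm_pow_lt hq.2 (k := 2) (by norm_num))
    have n3 := E_ne (norm_pow_lt hq.2 (k := 3) (by norm_num))
    have n6 := E_ne (norm_pow_lt hq.2 (k := 6) (by norm_num))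
    have := hq.1
    unfold F6
    simp_all

lemma GS_a8 (a8 : ℕ → ℤ) (ha8 : ∀ z : ℂ, 0 < z.im →
      dedekindEta (2 * z) ^ (4 : ℤ) * dedekindEta (4 * z) ^ (4 : ℤ)
        = ∑' m : ℕ, (a8 (m + 1) : ℂ) * Complex.exp (2 * Real.pi * Complex.I * z) ^ (m + 1)) : GS (Z a8) F8 := by
  refine GS_of_tsum (fun q hq0 hq => ?_) ?_
  · obtain ⟨z, hz, hzq⟩ := exists_z hq0 hq
    have h := ha8 z hz
    obtain ⟨u, hu0, hu, h1, hd⟩ := eta_fact q z hzq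
    have h2 := hd 2
    have h4 := hd 4
    push_cast at h2 h4
    rw [hzq] at h
    rw [← h, h2, h4, F8]
    generalize E (q ^ 2) = e2 at *
    generalize E (q ^ 4) = e4 at *
    rw [← hu]
    simp only [zpow_ofNat]
    ring
  · filter_upwards [ev_small] with q hq
    have n2 := E_ne (norm_pow_lt hq.2 (k := 2) (by norm_num))
    have n4 := E_ne (norm_pow_lt hq.2 (k := 4) (by norm_num))
    have := hq.1
    unfold F8
    simp_all

lemma GS_a16 (a16 : ℕ → ℤ) (ha16 : ∀ z : ℂ, 0 < z.im →
      dedekindEta (2 * z) ^ (-4 : ℤ) * dedekindEta (4 * z) ^ (16 : ℤ) * dedekindEta (8 * z) ^ (-4 : ℤ)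
        = ∑' m : ℕ, (a16 (m + 1) : ℂ) * Complex.exp (2 * Real.pi * Complex.I * z) ^ (m + 1)) : GS (Z a16) F16 := by
  refine GS_of_tsum (fun q hq0 hq => ?_) ?_
  · obtain ⟨z, hz, hzq⟩ := exists_z hq0 hq
    have h := ha16 z hz
    obtain ⟨u, hu0, hu, h1, hd⟩ := eta_fact q z hzq
    have h2 := hd 2
    have h4 := hd 4
    have h8 := hd 8
    push_cast at h2 h4 h8
    rw [hzq] at h
    rw [← h, h2, h4, h8, F16]
    have n2 := E_ne (norm_pow_lt hq (k := 2) (by norm_num))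
    have n8 := E_ne (norm_pow_lt hq (k := 8) (by norm_num))
    generalize E (q ^ 2) = e2 at *
    generalize E (q ^ 4) = e4 at *
    generalize E (q ^ 8) = e8 at *
    rw [← hu]
    simp only [zpow_neg, zpow_ofNat]
    field_simp
  · filter_upwards [ev_small] with q hq
    have n2 := E_ne (norm_pow_lt hq.2 (k := 2) (by norm_num))
    have n4 := E_ne (norm_pow_lt hq.2 (k := 4) (by norm_num))
    have n8 := E_ne (norm_pow_lt hq.2 (k := 8) (by norm_num))
    have := hq.1
    unfold F16
    simp_all

lemma GS_a24 (a24 : ℕ → ℤ) (ha24 : ∀ z : ℂ, 0 < z.im →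
      dedekindEta z ^ (-4 : ℤ) * dedekindEta (2 * z) ^ (11 : ℤ) * dedekindEta (3 * z) ^ (-4 : ℤ) *
          dedekindEta (4 * z) ^ (-3 : ℤ) * dedekindEta (6 * z) ^ (11 : ℤ) * dedekindEta (12 * z) ^ (-3 : ℤ)
        = ∑' m : ℕ, (a24 (m + 1) : ℂ) * Complex.exp (2 * Real.pi * Complex.I * z) ^ (m + 1)) : GS (Z a24) F24 := by
  refine GS_of_tsum (fun q hq0 hq => ?_) ?_
  · obtain ⟨z, hz, hzq⟩ := exists_z hq0 hq
    have h := ha24 z hz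
    obtain ⟨u, hu0, hu, h1, hd⟩ := eta_fact q z hzq
    have h2 := hd 2
    have h3 := hd 3
    have h4 := hd 4
    have h6 := hd 6
    have h12 := hd 12
    push_cast at h2 h3 h4 h6 h12
    rw [hzq] at h
    rw [← h, h1, h2, h3, h4, h6, h12, F24]
    have n1 := E_ne hq
    have n3 := E_ne (norm_pow_lt hq (k := 3) (by norm_num))
    have n4 := E_ne (norm_pow_lt hq (k := 4) (by norm_num))
    have n12 := E_ne (norm_pow_lt hq (k := 12) (by norm_num))
    generalize E q = e1 at *
    generalize E (q ^ 2) = e2 at *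
    generalize E (q ^ 3) = e3 at *
    generalize E (q ^ 4) = e4 at *
    generalize E (q ^ 6) = e6 at *
    generalize E (q ^ 12) = e12 at *
    rw [← hu]
    simp only [zpow_neg, zpow_ofNat]
    field_simp
  · filter_upwards [ev_small] with q hq
    have n1 := E_ne hq.2
    have n2 := E_ne (norm_pow_lt hq.2 (k := 2) (by norm_num))
    have n3 := E_ne (norm_pow_lt hq.2 (k := 3) (by norm_num))
    have n4 := E_ne (norm_pow_lt hq.2 (k := 4) (by norm_num))
    have n6 := E_ne (norm_pow_lt hq.2 (k := 6) (by norm_num))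
    have n12 := E_ne (norm_pow_lt hq.2 (k := 12) (by norm_num))
    have := hq.1
    unfold F24
    simp_all

lemma F12_ne : ∀ᶠ q in 𝓝[≠] 0, F12 q ≠ 0 := by
  have t1 := E_tendsto1
  have t2 := E_tendsto (k := 2) (by norm_num)
  have t3 := E_tendsto (k := 3) (by norm_num)
  have t4 := E_tendsto (k := 4) (by norm_num)
  have t6 := E_tendsto (k := 6) (by norm_num)
  have t12 := E_tendsto (k := 12) (by norm_num)
  have A := (((((t2.pow 2).mul (t3.pow 3)).mul (t4.pow 3)).mul (t6.pow 2)).div (t1.mul t12) (by norm_num)).sub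
    (id_tendsto.mul (((((t1.pow 3).mul (t2.pow 2)).mul (t6.pow 2)).mul (t12.pow 3)).div (t3.mul t4) (by norm_num)))
  have A' := A.eventually_ne (b₂ := 0) (by norm_num)
  filter_upwards [A', ev_small] with q h hq h0
  apply h
  refine mul_left_cancel₀ hq.1 ?_
  rw [mul_zero, ← h0, F12]
  simp only [Pi.div_apply]
  ring

lemma GS_a12 (a12 : ℕ → ℤ) (ha12 : ∀ z : ℂ, 0 < z.im →
      dedekindEta z ^ (-1 : ℤ) * dedekindEta (2 * z) ^ (2 : ℤ) * dedekindEta (3 * z) ^ (3 : ℤ) * dedekindEta (4 * z) ^ (3 : ℤ) *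
            dedekindEta (6 * z) ^ (2 : ℤ) * dedekindEta (12 * z) ^ (-1 : ℤ) -
          dedekindEta z ^ (3 : ℤ) * dedekindEta (2 * z) ^ (2 : ℤ) * dedekindEta (3 * z) ^ (-1 : ℤ) *
            dedekindEta (4 * z) ^ (-1 : ℤ) * dedekindEta (6 * z) ^ (2 : ℤ) * dedekindEta (12 * z) ^ (3 : ℤ)
        = ∑' m : ℕ, (a12 (m + 1) : ℂ) * Complex.exp (2 * Real.pi * Complex.I * z) ^ (m + 1)) : GS (Z a12) F12 := by
  refine GS_of_tsum (fun q hq0 hq => ?_) F12_ne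
  obtain ⟨z, hz, hzq⟩ := exists_z hq0 hq
  have h := ha12 z hz
  obtain ⟨u, hu0, hu, h1, hd⟩ := eta_fact q z hzq
  have h2 := hd 2
  have h3 := hd 3
  have h4 := hd 4
  have h6 := hd 6
  have h12 := hd 12
  push_cast at h2 h3 h4 h6 h12
  rw [hzq] at h
  rw [← h, h1, h2, h3, h4, h6, h12, F12]
  have n1 := E_ne hq
  have n3 := E_ne (norm_pow_lt hq (k := 3) (by norm_num))
  have n4 := E_ne (norm_pow_lt hq (k := 4) (by norm_num))
  have n12 := E_ne (norm_pow_lt hq (k := 12) (by norm_num))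
  generalize E q = e1 at *
  generalize E (q ^ 2) = e2 at *
  generalize E (q ^ 3) = e3 at *
  generalize E (q ^ 4) = e4 at *
  generalize E (q ^ 6) = e6 at *
  generalize E (q ^ 12) = e12 at *
  rw [← hu]
  simp only [zpow_neg, zpow_ofNat]
  field_simp

lemma sigma_eq (n : ℕ) : ((ArithmeticFunction.sigma 3 n : ℕ) : ℂ) = (sigma3 n : ℂ) := by
  simp [sigma3, ArithmeticFunction.sigma_apply]

lemma GS_Eis : GS (fun n => if n = 0 then 1 else 240 * (sigma3 n : ℂ)) Eis := by
  have hs : ∀ᶠ q in 𝓝[≠] 0, Summable fun n : ℕ => ((ArithmeticFunction.sigma 3 (n + 1) : ℕ) : ℂ) * q ^ (n + 1) := by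
    filter_upwards [ev_small] with q hq
    have h5 : Summable fun n : ℕ => ((n : ℂ) ^ 4 * q ^ n) := summable_pow_mul_geometric_of_norm_lt_one 4 hq.2
    have h6 := ((summable_nat_add_iff 1).mpr h5).norm
    refine Summable.of_norm_bounded h6 fun n => ?_
    rw [norm_mul, norm_mul]
    refine mul_le_mul_of_nonneg_right ?_ (norm_nonneg _)
    rw [← Nat.cast_pow, Complex.norm_natCast, Complex.norm_natCast]
    exact_mod_cast ArithmeticFunction.sigma_le_pow_succ 3 (n + 1)
  filter_upwards [hs] with q h
  rw [← hasSum_nat_add_iff' 1]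
  simp only [Nat.add_eq_zero_iff, one_ne_zero, and_false, if_false, range_one, sum_singleton, if_true, pow_zero, mul_one]
  rw [Eis, add_sub_cancel_left]
  have := h.hasSum.mul_left 240
  simpa only [sigma_eq, mul_assoc] using this

lemma hasSum_pi (n : ℕ) : ∀ (f : Fin n → ℤ → ℂ) (a : Fin n → ℂ), (∀ i, HasSum (f i) (a i)) →
    HasSum (fun x : Fin n → ℤ => ∏ i, f i (x i)) (∏ i, a i) := by
  induction n with
  | zero =>
    intro f a _
    simp
  | succ n ih =>
    intro f a h
    have ih := ih (fun i => f i.succ) (fun i => a i.succ) fun i => h _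
    have h0 := h 0
    have n0 : Summable fun k : ℤ => ‖f 0 k‖ := h0.summable.norm
    have n1 : Summable fun x : Fin n → ℤ => ‖∏ i : Fin n, f i.succ (x i)‖ := ih.summable.norm
    have hsm : Summable fun x : ℤ × (Fin n → ℤ) => f 0 x.1 * ∏ i : Fin n, f i.succ (x.2 i) :=
      summable_mul_of_summable_norm (f := f 0) (g := fun x : Fin n → ℤ => ∏ i : Fin n, f i.succ (x i)) n0 n1
    have hm := HasSum.mul h0 ih hsm
    rw [← (Fin.consEquiv (fun _ => ℤ)).hasSum_iff, Fin.prod_univ_succ]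
    have e : (fun x : Fin (n + 1) → ℤ => ∏ i, f i (x i)) ∘ (Fin.consEquiv (fun _ => ℤ)) =
        fun x : ℤ × (Fin n → ℤ) => f 0 x.1 * ∏ i : Fin n, f i.succ (x.2 i) := by
      funext x
      simp [Fin.prod_univ_succ, Fin.consEquiv]
    rw [e]
    exact hm

lemma prod_zpow_sum {q : ℂ} (hq : q ≠ 0) (s : Finset (Fin 8)) (g : Fin 8 → ℤ) :
    ∏ i ∈ s, q ^ g i = q ^ (∑ i ∈ s, g i) := by
  induction s using Finset.induction_on with
  | empty => simp
  | insert a s ha ih => rw [Finset.prod_insert ha, Finset.sum_insert ha, ih, zpow_add₀ hq]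

lemma GS_rep (a : Fin 8 → ℕ) (ha : ∀ i, a i ≠ 0) : GS (fun n => (repCount a n : ℂ)) (fun q => ∏ i, phi (q ^ a i)) := by
  filter_upwards [ev_small] with q hq
  have h := hasSum_pi 8 (fun i n => (q ^ a i) ^ (n ^ 2)) (fun i => phi (q ^ a i))
    fun i => hasSum_phi (pow_ne_zero _ hq.1) (norm_pow_lt hq.2 (ha i))
  let m : (Fin 8 → ℤ) → ℕ := fun x => (∑ i, (a i : ℤ) * x i ^ 2).toNat
  have hm : ∀ x, ((m x : ℕ) : ℤ) = ∑ i, (a i : ℤ) * x i ^ 2 := fun x =>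
    Int.toNat_of_nonneg (Finset.sum_nonneg fun i _ => by positivity)
  have h1 : HasSum (fun x : Fin 8 → ℤ => q ^ (m x)) (∏ i, phi (q ^ a i)) := by
    convert h using 2 with x
    rw [← zpow_natCast, hm]
    simp only [pz]
    exact (prod_zpow_sum hq.1 _ _).symm
  rw [← (Equiv.sigmaFiberEquiv m).hasSum_iff] at h1
  have hfib : ∀ n : ℕ, HasSum (fun x : {x // m x = n} => q ^ n) ((repCount a n : ℂ) * q ^ n) := by
    intro n
    have hs := h1.summable.sigma_factor n
    have hs' : Summable (fun x : {x // m x = n} => q ^ n) := by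
      refine hs.congr fun x => ?_
      simp [Equiv.sigmaFiberEquiv, x.2]
    have := hs'.hasSum
    rw [tsum_const, nsmul_eq_mul] at this
    have hc : Nat.card {x // m x = n} = repCount a n := by
      refine Nat.card_congr (Equiv.subtypeEquivRight fun x => ?_)
      rw [← hm]; exact Nat.cast_inj.symm
    rwa [hc] at this
  refine h1.sigma fun n => ?_
  refine (hfib n).congr_fun fun x => ?_
  simp [Equiv.sigmaFiberEquiv, x.2]

end RF

namespace RF
open Filter Topology

lemma chi4_eq (n : ℕ) : (chi4 n : ℂ) = (1 - (-1) ^ n) / 2 := by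
  unfold chi4
  rcases Nat.even_or_odd n with h | h
  · have h' : n % 2 ≠ 1 := by rw [Nat.even_iff] at h; omega
    rw [if_neg h', h.neg_one_pow]; simp
  · have h' : n % 2 = 1 := Nat.odd_iff.mp h
    rw [if_pos h', h.neg_one_pow]; norm_num

lemma chiM4_eq (n : ℕ) : (chiMinus4 n : ℂ) = (I ^ n - (-I) ^ n) / (2 * I) := by
  unfold chiMinus4
  have h4 : I ^ 4 = 1 := I_pow_four
  have h4' : (-I) ^ 4 = 1 := by rw [Even.neg_pow (by decide)]; exact I_pow_four
  rw [ZMod.χ₄_nat_mod_four, ← Nat.div_add_mod n 4, pow_add, pow_add, pow_mul, pow_mul, h4, h4', one_pow]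
  rw [show (4 * (n / 4) + n % 4) % 4 = n % 4 by omega]
  have hr : n % 4 < 4 := Nat.mod_lt _ (by norm_num)
  have hI := I_ne_zero
  generalize n % 4 = r at *
  have c0 : ZMod.χ₄ ((0 : ℕ) : ZMod 4) = 0 := by decide
  have c1 : ZMod.χ₄ ((1 : ℕ) : ZMod 4) = 1 := by decide
  have c2 : ZMod.χ₄ ((2 : ℕ) : ZMod 4) = 0 := by decide
  have c3 : ZMod.χ₄ ((3 : ℕ) : ZMod 4) = -1 := by decide
  interval_cases r
  · rw [c0]; simp
  · rw [c1]; field_simp; push_cast; ring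
  · rw [c2]; simp
  · rw [c3, eq_div_iff (mul_ne_zero two_ne_zero hI)]
    push_cast
    linear_combination (-2 * I) * I_sq

lemma GS.odd {a : ℕ → ℤ} {f : ℂ → ℂ} (h : GS (Z a) f) :
    GS (Z fun m => chi4 m * a m) (fun q => (f q - f (-q)) / 2) := by
  refine ((h.sub (h.twist (w := -1) (by norm_num))).div 2).congr (fun n => ?_) (fun q => ?_)
  · unfold Z
    split_ifs
    · simp
    · push_cast; rw [chi4_eq]; ring
  · simp

lemma GS.oddI {a : ℕ → ℤ} {f : ℂ → ℂ} (h : GS (Z a) f) :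
    GS (Z fun m => chiMinus4 m * a m) (fun q => (f (I * q) - f (-(I * q))) / (2 * I)) := by
  refine (((h.twist (w := I) I_ne_zero).sub (h.twist (w := -I) (neg_ne_zero.mpr I_ne_zero))).div (2 * I)).congr
    (fun n => ?_) (fun q => ?_)
  · unfold Z
    split_ifs
    · simp
    · push_cast; rw [chiM4_eq]; ring
  · simp

lemma Z_pos {a : ℕ → ℤ} {n : ℕ} (hn : 0 < n) : Z a n = (((a n : ℤ) : ℚ) : ℂ) := by
  simp [Z, hn.ne']

lemma div_ne {n k : ℕ} (hn : 0 < n) (h : k ∣ n) : n / k ≠ 0 := by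
  obtain ⟨m, rfl⟩ := h
  have hk : 0 < k := Nat.pos_of_mul_pos_right hn
  rw [Nat.mul_div_cancel_left _ hk]
  rintro rfl
  simp at hn

lemma Z_Dv {a : ℕ → ℤ} {n k : ℕ} (hn : 0 < n) :
    (if k ∣ n then Z a (n / k) else 0) = ((Dv a k n : ℚ) : ℂ) := by
  unfold Dv Z
  split_ifs with h h'
  · exact absurd h' (div_ne hn h)
  · simp
  · simp

lemma Eis_Dv {n k : ℕ} (hn : 0 < n) :
    (if k ∣ n then (if n / k = 0 then 1 else 240 * (sigma3 (n / k) : ℂ)) else 0) = 240 * ((Dv sigma3 k n : ℚ) : ℂ) := by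
  unfold Dv
  split_ifs with h h'
  · exact absurd h' (div_ne hn h)
  · simp
  · simp

end RF
theorem representation_formula_15
    (a6 a8 a12 a16 a24 : ℕ → ℤ)
    (ha6 : ∀ z : ℂ, 0 < z.im →
      dedekindEta z ^ (2 : ℤ) * dedekindEta (2 * z) ^ (2 : ℤ) * dedekindEta (3 * z) ^ (2 : ℤ) * dedekindEta (6 * z) ^ (2 : ℤ)
        = ∑' m : ℕ, (a6 (m + 1) : ℂ) * Complex.exp (2 * Real.pi * Complex.I * z) ^ (m + 1))
    (ha8 : ∀ z : ℂ, 0 < z.im →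
      dedekindEta (2 * z) ^ (4 : ℤ) * dedekindEta (4 * z) ^ (4 : ℤ)
        = ∑' m : ℕ, (a8 (m + 1) : ℂ) * Complex.exp (2 * Real.pi * Complex.I * z) ^ (m + 1))
    (ha12 : ∀ z : ℂ, 0 < z.im →
      dedekindEta z ^ (-1 : ℤ) * dedekindEta (2 * z) ^ (2 : ℤ) * dedekindEta (3 * z) ^ (3 : ℤ) * dedekindEta (4 * z) ^ (3 : ℤ) *
            dedekindEta (6 * z) ^ (2 : ℤ) * dedekindEta (12 * z) ^ (-1 : ℤ) -
          dedekindEta z ^ (3 : ℤ) * dedekindEta (2 * z) ^ (2 : ℤ) * dedekindEta (3 * z) ^ (-1 : ℤ) *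
            dedekindEta (4 * z) ^ (-1 : ℤ) * dedekindEta (6 * z) ^ (2 : ℤ) * dedekindEta (12 * z) ^ (3 : ℤ)
        = ∑' m : ℕ, (a12 (m + 1) : ℂ) * Complex.exp (2 * Real.pi * Complex.I * z) ^ (m + 1))
    (ha16 : ∀ z : ℂ, 0 < z.im →
      dedekindEta (2 * z) ^ (-4 : ℤ) * dedekindEta (4 * z) ^ (16 : ℤ) * dedekindEta (8 * z) ^ (-4 : ℤ)
        = ∑' m : ℕ, (a16 (m + 1) : ℂ) * Complex.exp (2 * Real.pi * Complex.I * z) ^ (m + 1))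
    (ha24 : ∀ z : ℂ, 0 < z.im →
      dedekindEta z ^ (-4 : ℤ) * dedekindEta (2 * z) ^ (11 : ℤ) * dedekindEta (3 * z) ^ (-4 : ℤ) *
          dedekindEta (4 * z) ^ (-3 : ℤ) * dedekindEta (6 * z) ^ (11 : ℤ) * dedekindEta (12 * z) ^ (-3 : ℤ)
        = ∑' m : ℕ, (a24 (m + 1) : ℂ) * Complex.exp (2 * Real.pi * Complex.I * z) ^ (m + 1))
    (n : ℕ) (hn : 0 < n) :
    (repCount ![1, 2, 3, 4, 4, 6, 6, 6] n : ℚ) =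
    (((1 : ℚ) / 8) * (sigma3 n : ℚ)
      + ((-1 : ℚ) / 8) * Dv sigma3 2 n
      + ((-9 : ℚ) / 8) * Dv sigma3 3 n
      + ((9 : ℚ) / 8) * Dv sigma3 6 n
      + (2 : ℚ) * Dv sigma3 8 n
      + (-32 : ℚ) * Dv sigma3 16 n
      + (-18 : ℚ) * Dv sigma3 24 n
      + (288 : ℚ) * Dv sigma3 48 n
      + (-4 : ℚ) * Dv a6 4 n
      + (-32 : ℚ) * Dv a6 8 n
      + ((-1 : ℚ) / 8) * (a8 n : ℚ)
      + ((-5 : ℚ) / 2) * Dv a8 2 n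
      + ((9 : ℚ) / 8) * Dv a8 3 n
      + ((-27 : ℚ) / 2) * Dv a8 6 n
      + ((3 : ℚ) / 8) * (a12 n : ℚ)
      + (2 : ℚ) * Dv a12 2 n
      + (6 : ℚ) * Dv a12 4 n
      + ((-1 : ℚ) / 4) * (a16 n : ℚ)
      + ((-9 : ℚ) / 4) * Dv a16 3 n
      + ((5 : ℚ) / 8) * ((chi4 n * a24 n : ℤ) : ℚ)
      + ((3 : ℚ) / 2) * Dv (fun m => chi4 m * a24 m) 2 n
      + (1 : ℚ) * ((chiMinus4 n * a6 n : ℤ) : ℚ)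
      + ((1 : ℚ) / 2) * ((chiMinus4 n * a12 n : ℤ) : ℚ)
      + ((-1 : ℚ) / 4) * ((chiMinus4 n * a24 n : ℤ) : ℚ)) := by
  have G6 := RF.GS_a6 a6 ha6
  have G8 := RF.GS_a8 a8 ha8
  have G12 := RF.GS_a12 a12 ha12
  have G16 := RF.GS_a16 a16 ha16
  have G24 := RF.GS_a24 a24 ha24
  have GE := RF.GS_Eis
  have GR := RF.GS_rep ![1, 2, 3, 4, 4, 6, 6, 6] (by decide)
  have s2 : (2 : ℕ) ≠ 0 := by norm_num
  have s3 : (3 : ℕ) ≠ 0 := by norm_num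
  have s4 : (4 : ℕ) ≠ 0 := by norm_num
  have s6 : (6 : ℕ) ≠ 0 := by norm_num
  have s8 : (8 : ℕ) ≠ 0 := by norm_num
  have gE := (((((((GE.div 8).sub ((GE.subst s2).div 8)).sub ((GE.subst s3).mul_left (9 / 8))).add
    ((GE.subst s6).mul_left (9 / 8))).add ((GE.subst s8).mul_left 2)).sub
    ((GE.subst (k := 16) (by norm_num)).mul_left 32)).sub ((GE.subst (k := 24) (by norm_num)).mul_left 18)).add
    ((GE.subst (k := 48) (by norm_num)).mul_left 288)
  have g1 := ((((((gE.div 240).sub ((G6.subst s4).mul_left 4)).sub ((G6.subst s8).mul_left 32)).sub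
    (G8.mul_left (1 / 8))).sub ((G8.subst s2).mul_left (5 / 2))).add ((G8.subst s3).mul_left (9 / 8))).sub
    ((G8.subst s6).mul_left (27 / 2))
  have g2 := ((((g1.add (G12.mul_left (3 / 8))).add ((G12.subst s2).mul_left 2)).add ((G12.subst s4).mul_left 6)).sub
    (G16.mul_left (1 / 4))).sub ((G16.subst s3).mul_left (9 / 4))
  have g3 := ((((g2.add (G24.odd.mul_left (5 / 8))).add ((G24.odd.subst s2).mul_left (3 / 2))).add G6.oddI).add
    (G12.oddI.mul_left (1 / 2))).sub (G24.oddI.mul_left (1 / 4))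
  have key := GR.unique g3 (by
    filter_upwards [RF.main RF.eisProp] with q hq
    rw [← hq]
    simp [Fin.prod_univ_succ]
    ring)
  have kn := congrFun key n
  simp only [RF.Z_Dv hn, RF.Eis_Dv hn, RF.Z_pos hn, hn.ne', if_false] at kn
  have cast_inj : ∀ x y : ℚ, (x : ℂ) = (y : ℂ) → x = y := fun x y h => Rat.cast_injective h
  apply cast_inj
  push_cast at kn ⊢
  rw [kn]
  ring
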